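/- arXiv:2502.14490 — 5 statements merged into one kernel-verified Lean document; each statement's English description precedes it below -/
import Mathlib

section
/- Let f : ℂ → ℂ be holomorphic on the open right half-plane Π₊ = {z ∈ ℂ : 0 < Re z} and suppose sup_{u>0} ∫_ℝ |f(u+iv)|² dv < ∞. Then there exists a measurable function G : ℝ → ℂ such that G(w) = 0 for almost every w > 0, ∫_{-∞}^0 |G(w)|² dw < ∞, and for every z ∈ ℂ with Re z > 0 one has f(z) = (1/√(2π)) ∫_{-∞}^0 e^{zw} G(w) dw. -/
open MeasureTheory Set
open scoped ENNReal NNReal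

open Filter Topology

lemma integrable_inv_sq_add_sub_sq {a : ℝ} (ha : 0 < a) (y : ℝ) :
    Integrable fun v : ℝ ↦ (a ^ 2 + (v - y) ^ 2)⁻¹ := by
  have h := ((integrable_inv_one_add_sq.comp_div ha.ne').comp_sub_right y).const_mul (a ^ 2)⁻¹
  refine h.congr (.of_forall fun v ↦ ?_)
  simp only
  rw [← mul_inv]
  congr 1
  field_simp

lemma integral_inv_sq_add_sub_sq {a : ℝ} (ha : 0 < a) (y : ℝ) :
    ∫ v : ℝ, (a ^ 2 + (v - y) ^ 2)⁻¹ = Real.pi / a := by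
  have h (v : ℝ) : (a ^ 2 + (v - y) ^ 2)⁻¹ = (a ^ 2)⁻¹ * (1 + ((v - y) / a) ^ 2)⁻¹ := by
    rw [← mul_inv]
    congr 1
    field_simp
  simp_rw [h]
  rw [integral_const_mul, integral_sub_right_eq_self (fun v ↦ (1 + (v / a) ^ 2)⁻¹) y,
    Measure.integral_comp_div (fun v ↦ (1 + v ^ 2)⁻¹), integral_univ_inv_one_add_sq,
    abs_of_pos ha, smul_eq_mul]
  field_simp

/-- The integrals of a holomorphic function over two vertical lines agree if the function is
integrable over the strip between them. -/
lemma integral_vertical_line_eq {F : ℂ → ℂ} {u R : ℝ} (huR : u ≤ R)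
    (hF : DifferentiableOn ℂ F {z | u ≤ z.re})
    (hu : Integrable fun v : ℝ ↦ F (u + v * Complex.I))
    (hR : Integrable fun v : ℝ ↦ F (R + v * Complex.I))
    (hs : Integrable (fun p : ℝ × ℝ ↦ F (p.1 + p.2 * Complex.I))
      ((volume.restrict (Ioc u R)).prod volume)) :
    ∫ v : ℝ, F (u + v * Complex.I) = ∫ v : ℝ, F (R + v * Complex.I) := by
  have hH : Integrable fun T : ℝ ↦ ∫ x in u..R, F (x + T * Complex.I) := by
    simpa only [intervalIntegral.integral_of_le huR] using hs.integral_prod_right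
  have hD (T : ℝ) :
      Complex.I * ((∫ v in -T..T, F (R + v * Complex.I)) - ∫ v in -T..T, F (u + v * Complex.I)) =
        (∫ x in u..R, F (x + T * Complex.I)) - ∫ x in u..R, F (x + (-T : ℝ) * Complex.I) := by
    have := Complex.integral_boundary_rect_eq_zero_of_differentiableOn F
      (u + (-T : ℝ) * Complex.I) (R + T * Complex.I) (hF.mono fun z hz ↦ by
        have := hz.1
        simp [uIcc_of_le huR] at this
        exact this.1)
    simp at this
    simp only [Complex.ofReal_neg, neg_mul]
    linear_combination this
  have hlim := (intervalIntegral_tendsto_integral hR tendsto_neg_atTop_atBot tendsto_id).sub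
    (intervalIntegral_tendsto_integral hu tendsto_neg_atTop_atBot tendsto_id)
  have hlim' := hlim.const_mul Complex.I
  simp only [id, hD] at hlim'
  have h0 := IntegrableAtFilter.eq_zero_of_tendsto
    ((hH.sub hH.comp_neg).integrableAtFilter atTop) (fun s hs ↦ by
      obtain ⟨b, hb⟩ := mem_atTop_sets.1 hs
      rw [← top_le_iff, ← Real.volume_Ici (a := b)]
      exact measure_mono hb) hlim'
  simp at h0
  exact (sub_eq_zero.1 h0).symm

/-- `HardyBound f M`: `f` is holomorphic on the right half-plane, with the square integrals of its
modulus over vertical lines bounded by `M`. -/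
structure HardyBound (f : ℂ → ℂ) (M : ℝ) : Prop where
  diff : DifferentiableOn ℂ f {z | 0 < z.re}
  integrable {u : ℝ} (hu : 0 < u) : Integrable fun v : ℝ ↦ ‖f (u + v * Complex.I)‖ ^ 2
  le {u : ℝ} (hu : 0 < u) : ∫ v : ℝ, ‖f (u + v * Complex.I)‖ ^ 2 ≤ M

lemma DifferentiableOn.continuous_line {f : ℂ → ℂ} (hf : DifferentiableOn ℂ f {z | 0 < z.re})
    {u : ℝ} (hu : 0 < u) : Continuous fun v : ℝ ↦ f (u + v * Complex.I) :=
  hf.continuousOn.comp_continuous (by fun_prop) (by simpa using hu)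

lemma DifferentiableOn.continuousOn_prod {f : ℂ → ℂ} (hf : DifferentiableOn ℂ f {z | 0 < z.re})
    {u R : ℝ} (hu : 0 < u) :
    ContinuousOn (fun p : ℝ × ℝ ↦ f (p.1 + p.2 * Complex.I)) (Ioc u R ×ˢ univ) :=
  hf.continuousOn.comp (by fun_prop) fun p hp ↦ by simpa using hu.trans hp.1.1

lemma ContinuousOn.aestronglyMeasurable_strip {f : ℝ × ℝ → ℂ} {u R : ℝ}
    (hf : ContinuousOn f (Ioc u R ×ˢ univ)) :
    AEStronglyMeasurable f ((volume.restrict (Ioc u R)).prod volume) := by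
  have := hf.aestronglyMeasurable (μ := volume) (measurableSet_Ioc.prod MeasurableSet.univ)
  rwa [Measure.volume_eq_prod, ← Measure.prod_restrict, Measure.restrict_univ] at this

namespace HardyBound

variable {f : ℂ → ℂ} {M : ℝ}

lemma nonneg (hf : HardyBound f M) : 0 ≤ M :=
  (integral_nonneg fun _ ↦ by positivity).trans (hf.le one_pos)

lemma integrable_strip (hf : HardyBound f M) {u R : ℝ} (hu : 0 < u) :
    Integrable (fun p : ℝ × ℝ ↦ ‖f (p.1 + p.2 * Complex.I)‖ ^ 2)
      ((volume.restrict (Ioc u R)).prod volume) := by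
  have hm := (hf.diff.continuousOn_prod (R := R) hu).aestronglyMeasurable_strip.norm.pow 2
  refine (integrable_prod_iff hm).2 ⟨?_, ?_⟩
  · filter_upwards [ae_restrict_mem measurableSet_Ioc] with x hx
    exact hf.integrable (hu.trans hx.1)
  · refine Integrable.mono' (integrable_const M) hm.norm.integral_prod_right' ?_
    filter_upwards [ae_restrict_mem measurableSet_Ioc] with x hx
    rw [Real.norm_of_nonneg (integral_nonneg fun _ ↦ norm_nonneg _)]
    simpa using hf.le (hu.trans hx.1)

lemma sub {g : ℂ → ℂ} {N : ℝ} (hf : HardyBound f M) (hg : HardyBound g N) :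
    HardyBound (fun z ↦ f z - g z) (2 * M + 2 * N) := by
  have hle (a b : ℂ) : ‖a - b‖ ^ 2 ≤ 2 * ‖a‖ ^ 2 + 2 * ‖b‖ ^ 2 := by
    have := norm_sub_le a b
    nlinarith [sq_nonneg (‖a‖ - ‖b‖), norm_nonneg (a - b)]
  have hi {u : ℝ} (hu : 0 < u) := ((hf.integrable hu).const_mul 2).add
    ((hg.integrable hu).const_mul 2)
  have hd := hf.diff.sub hg.diff
  have hi' {u : ℝ} (hu : 0 < u) :
      Integrable fun v : ℝ ↦ ‖f (u + v * Complex.I) - g (u + v * Complex.I)‖ ^ 2 :=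
    (hi hu).mono' ((hd.continuous_line hu).norm.pow 2).aestronglyMeasurable
      (.of_forall fun v ↦ by simpa using hle _ _)
  refine ⟨hd, hi', fun hu ↦ ?_⟩
  refine (integral_mono (hi' hu) (hi hu) fun v ↦ hle _ _).trans ?_
  simp only [Pi.add_apply]
  rw [integral_add ((hf.integrable hu).const_mul 2) ((hg.integrable hu).const_mul 2),
    integral_const_mul, integral_const_mul]
  linarith [hf.le hu, hg.le hu]

lemma const_mul (hf : HardyBound f M) (c : ℂ) : HardyBound (fun z ↦ c * f z) (‖c‖ ^ 2 * M) where
  diff := hf.diff.const_mul c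
  integrable hu := by
    simpa only [norm_mul, mul_pow] using (hf.integrable hu).const_mul (‖c‖ ^ 2)
  le hu := by
    simp only [norm_mul, mul_pow]
    rw [integral_const_mul]
    gcongr
    exact hf.le hu

end HardyBound

lemma norm_add_mul_I_sub_sq (u v : ℝ) (z : ℂ) :
    ‖(u + v * Complex.I - z : ℂ)‖ ^ 2 = (u - z.re) ^ 2 + (v - z.im) ^ 2 := by
  rw [Complex.sq_norm, Complex.normSq_apply]
  simp
  ring

lemma hardyBound_inv_add {b : ℂ} (hb : 0 < b.re) :
    HardyBound (fun z ↦ (z + b)⁻¹) (Real.pi / b.re) := by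
  have h (u v : ℝ) : ‖(u + v * Complex.I + b : ℂ)⁻¹‖ ^ 2 =
      ((u + b.re) ^ 2 + (v - -b.im) ^ 2)⁻¹ := by
    have := norm_add_mul_I_sub_sq u v (-b)
    simp at this
    simp [this]
  refine ⟨?_, fun {u} hu ↦ ?_, fun {u} hu ↦ ?_⟩
  · refine DifferentiableOn.inv (by fun_prop) fun z hz h0 ↦ ?_
    have h1 := congrArg Complex.re h0
    simp at h1 hz
    linarith
  · simp only [h]
    exact integrable_inv_sq_add_sub_sq (by linarith) _
  · simp only [h]
    rw [integral_inv_sq_add_sub_sq (by linarith)]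
    gcongr
    linarith

namespace HardyBound

variable {f : ℂ → ℂ} {M : ℝ}

lemma continuous_mul_inv_sub (hf : HardyBound f M) {z : ℂ} {u : ℝ} (hu : 0 < u)
    (huz : u ≠ z.re) :
    Continuous fun v : ℝ ↦ f (u + v * Complex.I) * (u + v * Complex.I - z)⁻¹ := by
  refine (hf.diff.continuous_line hu).mul (Continuous.inv₀ (by fun_prop) fun v h ↦ huz ?_)
  have := congrArg Complex.re h
  simp at this
  linarith

lemma integrable_mul_inv_sub (hf : HardyBound f M) {z : ℂ} {u : ℝ} (hu : 0 < u)
    (huz : u ≠ z.re) :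
    Integrable fun v : ℝ ↦ f (u + v * Complex.I) * (u + v * Complex.I - z)⁻¹ := by
  have hp : 0 < |u - z.re| := abs_pos.2 (sub_ne_zero.2 huz)
  refine ((hf.integrable hu).add (integrable_inv_sq_add_sub_sq hp z.im)).mono'
    (hf.continuous_mul_inv_sub hu huz).aestronglyMeasurable (.of_forall fun v ↦ ?_)
  have h := norm_add_mul_I_sub_sq u v z
  rw [Pi.add_apply, sq_abs, ← h, norm_mul, norm_inv, ← inv_pow]
  nlinarith [sq_nonneg (‖f (u + v * Complex.I)‖ - ‖(u + v * Complex.I - z : ℂ)‖⁻¹),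
    sq_nonneg (‖f (u + v * Complex.I)‖ + ‖(u + v * Complex.I - z : ℂ)‖⁻¹)]

lemma norm_integral_mul_inv_sub_le (hf : HardyBound f M) {z : ℂ} {R δ : ℝ} (hR : 0 < R)
    (hRz : z.re < R) (hδ : 0 < δ) :
    ‖∫ v : ℝ, f (R + v * Complex.I) * (R + v * Complex.I - z)⁻¹‖ ≤
      δ * M + δ⁻¹ * (Real.pi / (R - z.re)) := by
  have hp : 0 < R - z.re := sub_pos.2 hRz
  have h1 := (hf.integrable hR).const_mul δ
  have h2 := (integrable_inv_sq_add_sub_sq hp z.im).const_mul δ⁻¹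
  refine (norm_integral_le_of_norm_le (h1.add h2) (.of_forall fun v ↦ ?_)).trans ?_
  · rw [Pi.add_apply, ← norm_add_mul_I_sub_sq R v z, norm_mul, norm_inv, ← inv_pow]
    set a := ‖f (R + v * Complex.I)‖
    set b := ‖(R + v * Complex.I - z : ℂ)‖⁻¹
    have e : δ * a ^ 2 + δ⁻¹ * b ^ 2 - 2 * (a * b) = δ⁻¹ * (δ * a - b) ^ 2 := by
      field_simp
      ring
    have : 0 ≤ δ⁻¹ * (δ * a - b) ^ 2 := by positivity
    have : 0 ≤ a * b := by positivity
    linarith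
  · simp only [Pi.add_apply]
    rw [integral_add h1 h2, integral_const_mul, integral_const_mul,
      integral_inv_sq_add_sub_sq hp]
    gcongr
    exact hf.le hR

lemma exists_norm_dslope_le (hf : HardyBound f M) {z : ℂ} (hz : 0 < z.re) (h0 : f z = 0)
    {u R : ℝ} (hu : 0 < u) : ∃ C : ℝ, ∀ σ ∈ Icc u R, ∀ v : ℝ,
      ‖dslope f z (σ + v * Complex.I)‖ ≤
        ‖f (σ + v * Complex.I)‖ ^ 2 + C * (1 ^ 2 + (v - z.im) ^ 2)⁻¹ := by
  have hnhds : {z : ℂ | 0 < z.re} ∈ 𝓝 z :=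
    (isOpen_lt continuous_const Complex.continuous_re).mem_nhds hz
  have hd := (Complex.differentiableOn_dslope hnhds).2 hf.diff
  obtain ⟨K, hK⟩ := (isCompact_Icc.reProdIm isCompact_Icc).exists_bound_of_continuousOn
    (hd.continuousOn.mono
      fun w (hw : w ∈ Icc u R ×ℂ Icc (z.im - 1) (z.im + 1)) ↦ hu.trans_le hw.1.1)
  refine ⟨2 * |K| + 2, fun σ hσ v ↦ ?_⟩
  have hq : 0 < 1 ^ 2 + (v - z.im) ^ 2 := by positivity
  by_cases hv : v ∈ Icc (z.im - 1) (z.im + 1)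
  · have h1 : ‖dslope f z (σ + v * Complex.I)‖ ≤ K := hK _ ⟨by simpa using hσ, by simpa using hv⟩
    have h2 : (v - z.im) ^ 2 ≤ 1 := by nlinarith [hv.1, hv.2]
    have h3 : |K| ≤ (2 * |K| + 2) * (1 ^ 2 + (v - z.im) ^ 2)⁻¹ := by
      rw [← div_eq_mul_inv, le_div_iff₀ hq]
      nlinarith [abs_nonneg K]
    nlinarith [le_abs_self K, sq_nonneg ‖f (σ + v * Complex.I)‖]
  · have h2 : 1 ≤ (v - z.im) ^ 2 := by
      by_contra! h
      rw [sq_lt_one_iff_abs_lt_one, abs_lt] at h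
      exact hv ⟨by linarith, by linarith⟩
    have hne : (σ + v * Complex.I : ℂ) ≠ z := by
      rintro rfl
      simp at h2
      linarith
    rw [dslope_of_ne _ hne, slope_def_field, h0, sub_zero, norm_div]
    have h3 := norm_add_mul_I_sub_sq σ v z
    set a := ‖f (σ + v * Complex.I)‖
    set d := ‖(σ + v * Complex.I - z : ℂ)‖
    have hd : 0 < d := norm_pos_iff.2 (sub_ne_zero.2 hne)
    have h4 : (d⁻¹) ^ 2 ≤ 2 * (1 ^ 2 + (v - z.im) ^ 2)⁻¹ := by
      rw [inv_pow, ← div_eq_mul_inv, inv_le_comm₀ (by positivity) (by positivity), inv_div,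
        h3]
      nlinarith [sq_nonneg (σ - z.re)]
    have h5 : 0 ≤ 2 * |K| * (1 ^ 2 + (v - z.im) ^ 2)⁻¹ := by positivity
    rw [div_eq_mul_inv]
    nlinarith [sq_nonneg (a - d⁻¹), sq_nonneg (a + d⁻¹)]

lemma integral_mul_inv_sub_eq_zero (hf : HardyBound f M) {z : ℂ} {u : ℝ} (hu : 0 < u)
    (huz : u < z.re) (h0 : f z = 0) :
    ∫ v : ℝ, f (u + v * Complex.I) * (u + v * Complex.I - z)⁻¹ = 0 := by
  have hz : 0 < z.re := hu.trans huz
  have hnhds : {z : ℂ | 0 < z.re} ∈ 𝓝 z :=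
    (isOpen_lt continuous_const Complex.continuous_re).mem_nhds hz
  have hd := (Complex.differentiableOn_dslope hnhds).2 hf.diff
  have hline {σ : ℝ} (hσ : σ ≠ z.re) (v : ℝ) : dslope f z (σ + v * Complex.I) =
      f (σ + v * Complex.I) * (σ + v * Complex.I - z)⁻¹ := by
    rw [dslope_of_ne, slope_def_field, h0, sub_zero, div_eq_mul_inv]
    rintro rfl
    simp at hσ
  have hconst {R : ℝ} (hR : z.re < R) :
      ∫ v : ℝ, f (u + v * Complex.I) * (u + v * Complex.I - z)⁻¹ =
        ∫ v : ℝ, f (R + v * Complex.I) * (R + v * Complex.I - z)⁻¹ := by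
    simp only [← hline huz.ne, ← hline hR.ne']
    refine integral_vertical_line_eq (huz.trans hR).le
      (hd.mono fun w (hw : u ≤ w.re) ↦ hu.trans_le hw) ?_ ?_ ?_
    · simpa only [hline huz.ne] using hf.integrable_mul_inv_sub hu huz.ne
    · simpa only [hline hR.ne'] using hf.integrable_mul_inv_sub (hz.trans hR) hR.ne'
    · obtain ⟨C, hC⟩ := hf.exists_norm_dslope_le hz h0 (R := R) hu
      refine Integrable.mono' ((hf.integrable_strip hu).add
        (((integrable_inv_sq_add_sub_sq one_pos z.im).const_mul C).comp_snd _))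
        (hd.continuousOn_prod hu).aestronglyMeasurable_strip ?_
      rw [← Measure.restrict_univ (μ := (volume : Measure ℝ)), Measure.prod_restrict]
      filter_upwards [ae_restrict_mem (measurableSet_Ioc.prod MeasurableSet.univ)] with p hp
      exact hC _ (Ioc_subset_Icc_self hp.1) _
  have hle {δ : ℝ} (hδ : 0 < δ) :
      ‖∫ v : ℝ, f (u + v * Complex.I) * (u + v * Complex.I - z)⁻¹‖ ≤ δ * (M + Real.pi) := by
    have hR : z.re < z.re + (δ ^ 2)⁻¹ := by
      have : 0 < (δ ^ 2)⁻¹ := by positivity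
      linarith
    rw [hconst hR]
    refine (hf.norm_integral_mul_inv_sub_le (hz.trans hR) hR hδ).trans_eq ?_
    rw [add_sub_cancel_left]
    field_simp
  have hlim : Tendsto (fun δ : ℝ ↦ δ * (M + Real.pi)) (𝓝[>] 0) (𝓝 0) := by
    have : Tendsto (fun δ : ℝ ↦ δ * (M + Real.pi)) (𝓝 0) (𝓝 (0 * (M + Real.pi))) :=
      tendsto_id.mul_const _
    rw [zero_mul] at this
    exact this.mono_left nhdsWithin_le_nhds
  exact norm_le_zero_iff.1 (ge_of_tendsto hlim
    (by filter_upwards [self_mem_nhdsWithin] with δ hδ using hle hδ))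

/-- **Cauchy's integral formula** for the half-plane. -/
lemma cauchy_formula (hf : HardyBound f M) {z : ℂ} {u : ℝ} (hu : 0 < u) (huz : 2 * u < z.re) :
    ∫ v : ℝ, f (u + v * Complex.I) * (u + v * Complex.I - z)⁻¹ = - (2 * Real.pi * f z) := by
  set b : ℂ := starRingEnd ℂ z - 2 * u
  have hb : 0 < b.re := by simp [b]; linarith
  have hp : 0 < z.re - u := by linarith
  have hg := (hardyBound_inv_add hb).const_mul (f z * (2 * (z.re - u)))
  have hzb : z + b = 2 * (z.re - u) := by
    rw [← add_sub_assoc, Complex.add_conj]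
    push_cast
    ring
  have hpC : (2 * (z.re - u) : ℂ) ≠ 0 := by exact_mod_cast (by positivity : 2 * (z.re - u) ≠ 0)
  have h0 := (hf.sub hg).integral_mul_inv_sub_eq_zero hu (by linarith) (z := z) (by
    rw [hzb, mul_assoc, mul_inv_cancel₀ hpC, mul_one, sub_self])
  simp only [sub_mul] at h0
  rw [integral_sub (hf.integrable_mul_inv_sub hu (by linarith))
    (hg.integrable_mul_inv_sub hu (by linarith)), sub_eq_zero] at h0
  rw [h0]
  have hk (v : ℝ) : f z * (2 * (z.re - u)) * (u + v * Complex.I + b)⁻¹ *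
      (u + v * Complex.I - z)⁻¹ = -(f z * (2 * (z.re - u))) *
        ((((z.re - u) ^ 2 + (v - z.im) ^ 2)⁻¹ : ℝ) : ℂ) := by
    rw [mul_assoc, ← mul_inv, neg_mul, ← mul_neg]
    congr 1
    push_cast
    rw [← inv_neg]
    congr 1
    simp only [b]
    rw [Complex.ext_iff]
    simp [pow_two]
    constructor <;> ring
  simp only [hk]
  rw [integral_const_mul, integral_complex_ofReal, integral_inv_sq_add_sub_sq hp]
  have hpC' : (z.re - u : ℂ) ≠ 0 := by exact_mod_cast hp.ne'
  push_cast
  field_simp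

end HardyBound

lemma norm_sum_mul_sq {ι : Type*} (s : Finset ι) (c g : ι → ℂ) :
    ((‖∑ i ∈ s, c i * g i‖ ^ 2 : ℝ) : ℂ) =
      ∑ i ∈ s, ∑ j ∈ s, starRingEnd ℂ (c i) * c j * (starRingEnd ℂ (g i) * g j) := by
  rw [Complex.ofReal_pow, ← Complex.conj_mul', map_sum, Finset.sum_mul_sum]
  simp only [map_mul]
  exact Finset.sum_congr rfl fun i _ ↦ Finset.sum_congr rfl fun j _ ↦ by ring

lemma norm_integral_mul_sq_le {f g : ℝ → ℂ} (hf : Integrable fun v ↦ ‖f v‖ ^ 2)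
    (hg : Integrable fun v ↦ ‖g v‖ ^ 2) (hfm : AEStronglyMeasurable f)
    (hgm : AEStronglyMeasurable g) :
    ‖∫ v, f v * g v‖ ^ 2 ≤ (∫ v, ‖f v‖ ^ 2) * ∫ v, ‖g v‖ ^ 2 := by
  have h2 : ENNReal.ofReal 2 = 2 := by simp
  have h := integral_mul_le_Lp_mul_Lq_of_nonneg (μ := volume) Real.HolderConjugate.two_two
    (f := fun v ↦ ‖f v‖) (g := fun v ↦ ‖g v‖) (.of_forall fun _ ↦ norm_nonneg _)
    (.of_forall fun _ ↦ norm_nonneg _)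
    (by rw [h2]; exact ((memLp_two_iff_integrable_sq_norm hfm).2 hf).norm)
    (by rw [h2]; exact ((memLp_two_iff_integrable_sq_norm hgm).2 hg).norm)
  simp only [Real.rpow_two, ← Real.sqrt_eq_rpow] at h
  have h' : ‖∫ v, f v * g v‖ ≤ √(∫ v, ‖f v‖ ^ 2) * √(∫ v, ‖g v‖ ^ 2) :=
    (norm_integral_le_integral_norm _).trans (by simpa only [norm_mul] using h)
  calc _ ≤ (√(∫ v, ‖f v‖ ^ 2) * √(∫ v, ‖g v‖ ^ 2)) ^ 2 := by gcongr
    _ = _ := by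
      rw [mul_pow, Real.sq_sqrt (integral_nonneg fun _ ↦ by positivity),
        Real.sq_sqrt (integral_nonneg fun _ ↦ by positivity)]

/-- The Gram matrix of the Cauchy kernels on a vertical line. -/
lemma integral_conj_inv_sub_mul_inv_sub {z w : ℂ} {u : ℝ} (hu : 0 < u) (hz : 2 * u < z.re)
    (hw : 2 * u < w.re) :
    Integrable (fun v : ℝ ↦
      starRingEnd ℂ (u + v * Complex.I - z)⁻¹ * (u + v * Complex.I - w)⁻¹) ∧
    ∫ v : ℝ, starRingEnd ℂ (u + v * Complex.I - z)⁻¹ * (u + v * Complex.I - w)⁻¹ =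
      2 * Real.pi * (starRingEnd ℂ z + w - 2 * u)⁻¹ := by
  have hb : 0 < (starRingEnd ℂ z - 2 * u).re := by simp; linarith
  have h := hardyBound_inv_add hb
  have hk (v : ℝ) : starRingEnd ℂ (u + v * Complex.I - z)⁻¹ * (u + v * Complex.I - w)⁻¹ =
      -((u + v * Complex.I + (starRingEnd ℂ z - 2 * u))⁻¹ * (u + v * Complex.I - w)⁻¹) := by
    rw [← neg_mul, ← inv_neg, map_inv₀]
    congr 2
    simp
    ring
  simp only [hk]
  refine ⟨(h.integrable_mul_inv_sub hu (by linarith)).neg, ?_⟩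
  rw [integral_neg, h.cauchy_formula hu hw, neg_neg]
  congr 2
  ring

namespace HardyBound

variable {f : ℂ → ℂ} {M : ℝ}

lemma norm_sum_sq_le_of_lt (hf : HardyBound f M) {ι : Type*} (s : Finset ι) (c z : ι → ℂ)
    {u : ℝ} (hu : 0 < u) (hz : ∀ i ∈ s, 2 * u < (z i).re) :
    2 * Real.pi * ‖∑ i ∈ s, c i * f (z i)‖ ^ 2 ≤
      M * (∑ i ∈ s, ∑ j ∈ s, starRingEnd ℂ (c i) * c j *
        (starRingEnd ℂ (z i) + z j - 2 * u)⁻¹).re := by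
  set K : ℝ → ℂ := fun v ↦ ∑ i ∈ s, c i * (u + v * Complex.I - z i)⁻¹ with hK
  have hne {i} (hi : i ∈ s) : u ≠ (z i).re := by linarith [hz i hi]
  have hKc : Continuous K := by
    refine continuous_finsetSum _ fun i hi ↦ continuous_const.mul
      (Continuous.inv₀ (by fun_prop) fun v h ↦ hne hi ?_)
    have := congrArg Complex.re h
    simp at this
    linarith
  have hcauchy : ∫ v : ℝ, f (u + v * Complex.I) * K v =
      -(2 * Real.pi * ∑ i ∈ s, c i * f (z i)) := by
    have (v : ℝ) : f (u + v * Complex.I) * K v =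
        ∑ i ∈ s, c i * (f (u + v * Complex.I) * (u + v * Complex.I - z i)⁻¹) := by
      rw [hK, Finset.mul_sum]
      exact Finset.sum_congr rfl fun i _ ↦ by ring
    simp only [this]
    rw [integral_finsetSum _ fun i hi ↦ (hf.integrable_mul_inv_sub hu (hne hi)).const_mul _,
      Finset.mul_sum, ← Finset.sum_neg_distrib]
    refine Finset.sum_congr rfl fun i hi ↦ ?_
    rw [integral_const_mul, hf.cauchy_formula hu (hz i hi)]
    ring
  have hi (i) (hi : i ∈ s) (j) (hj : j ∈ s) :=
    integral_conj_inv_sub_mul_inv_sub hu (hz i hi) (hz j hj)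
  have hKi : Integrable fun v ↦ ((‖K v‖ ^ 2 : ℝ) : ℂ) := by
    simp only [hK, norm_sum_mul_sq]
    exact integrable_finsetSum _ fun i h ↦ integrable_finsetSum _ fun j h' ↦
      (hi i h j h').1.const_mul _
  have hKint : ((∫ v, ‖K v‖ ^ 2 : ℝ) : ℂ) = 2 * Real.pi * ∑ i ∈ s, ∑ j ∈ s,
      starRingEnd ℂ (c i) * c j * (starRingEnd ℂ (z i) + z j - 2 * u)⁻¹ := by
    rw [← integral_complex_ofReal]
    simp only [hK, norm_sum_mul_sq]
    rw [integral_finsetSum _ fun i h ↦ integrable_finsetSum _ fun j h' ↦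
      (hi i h j h').1.const_mul _, Finset.mul_sum]
    refine Finset.sum_congr rfl fun i h ↦ ?_
    rw [integral_finsetSum _ fun j h' ↦ (hi i h j h').1.const_mul _, Finset.mul_sum]
    refine Finset.sum_congr rfl fun j h' ↦ ?_
    rw [integral_const_mul, (hi i h j h').2]
    ring
  have hKre := congrArg Complex.re hKint
  rw [Complex.ofReal_re, ← Complex.ofReal_ofNat, ← Complex.ofReal_mul,
    Complex.re_ofReal_mul, Complex.ofReal_ofNat] at hKre
  have hcs := norm_integral_mul_sq_le (hf.integrable hu) hKi.re
    (hf.diff.continuous_line hu).aestronglyMeasurable hKc.aestronglyMeasurable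
  rw [hcauchy, norm_neg, norm_mul, mul_pow] at hcs
  have h2pi : ‖(2 * Real.pi : ℂ)‖ = 2 * Real.pi := by simp [abs_of_pos Real.pi_pos]
  rw [h2pi] at hcs
  have hle := hcs.trans (mul_le_mul_of_nonneg_right (hf.le hu)
    (integral_nonneg fun _ ↦ by positivity))
  rw [hKre] at hle
  have hpi : 0 < 2 * Real.pi := by positivity
  refine le_of_mul_le_mul_left ?_ hpi
  linarith

lemma norm_sum_sq_le (hf : HardyBound f M) {ι : Type*} (s : Finset ι) (c z : ι → ℂ)
    (hz : ∀ i ∈ s, 0 < (z i).re) :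
    2 * Real.pi * ‖∑ i ∈ s, c i * f (z i)‖ ^ 2 ≤
      M * (∑ i ∈ s, ∑ j ∈ s, starRingEnd ℂ (c i) * c j *
        (starRingEnd ℂ (z i) + z j)⁻¹).re := by
  have hlim : Tendsto (fun u : ℝ ↦ M * (∑ i ∈ s, ∑ j ∈ s, starRingEnd ℂ (c i) * c j *
      (starRingEnd ℂ (z i) + z j - 2 * u)⁻¹).re) (𝓝[>] 0)
      (𝓝 (M * (∑ i ∈ s, ∑ j ∈ s, starRingEnd ℂ (c i) * c j *
        (starRingEnd ℂ (z i) + z j)⁻¹).re)) := by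
    refine Tendsto.const_mul _ ((Complex.continuous_re.tendsto _).comp
      (tendsto_finsetSum _ fun i hi ↦ tendsto_finsetSum _ fun j hj ↦
        Tendsto.const_mul _ (Tendsto.inv₀ ?_ fun h ↦ ?_)))
    · have : Continuous fun u : ℝ ↦ starRingEnd ℂ (z i) + z j - 2 * (u : ℂ) := by fun_prop
      simpa using (this.tendsto 0).mono_left nhdsWithin_le_nhds
    · have := congrArg Complex.re h
      simp at this
      linarith [hz i hi, hz j hj]
  refine ge_of_tendsto hlim ?_
  have hsmall : ∀ᶠ u : ℝ in 𝓝[>] 0, ∀ i ∈ s, 2 * u < (z i).re := by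
    refine (Filter.eventually_all_finset s).2 fun i hi ↦ nhdsWithin_le_nhds ?_
    filter_upwards [gt_mem_nhds (half_pos (hz i hi))] with u hu
    linarith
  filter_upwards [hsmall, self_mem_nhdsWithin] with u h hu
  exact hf.norm_sum_sq_le_of_lt s c z hu h

end HardyBound

lemma memLp_exp_mul {z : ℂ} (hz : 0 < z.re) :
    MemLp (fun w : ℝ ↦ Complex.exp (z * w)) 2 (volume.restrict (Iic 0)) := by
  refine (memLp_two_iff_integrable_sq_norm (by fun_prop)).2 ?_
  have h := (integrableOn_exp_mul_complex_Iic (a := 2 * z) (by simpa using hz) 0).norm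
  refine h.congr (.of_forall fun w ↦ ?_)
  simp only [Complex.norm_exp]
  rw [← Real.exp_nat_mul]
  congr 1
  simp
  ring

/-- The exponential `w ↦ exp (z * w)` as a square integrable function on the negative half-line. -/
noncomputable def expLp (z : {z : ℂ // 0 < z.re}) : Lp ℂ 2 (volume.restrict (Iic (0 : ℝ))) :=
  (memLp_exp_mul z.2).toLp _

lemma inner_expLp (z w : {z : ℂ // 0 < z.re}) :
    inner ℂ (expLp z) (expLp w) = (starRingEnd ℂ (z : ℂ) + w)⁻¹ := by
  rw [L2.inner_def]
  have : ∫ t : ℝ in Iic 0, inner ℂ (expLp z t) (expLp w t) =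
      ∫ t : ℝ in Iic 0, Complex.exp ((starRingEnd ℂ (z : ℂ) + w) * t) := by
    refine integral_congr_ae ?_
    filter_upwards [(memLp_exp_mul z.2).coeFn_toLp, (memLp_exp_mul w.2).coeFn_toLp] with t h1 h2
    rw [expLp, expLp, h1, h2, RCLike.inner_apply, ← Complex.exp_conj, mul_comm,
      ← Complex.exp_add]
    congr 1
    simp
    ring
  rw [this, integral_exp_mul_complex_Iic (by simpa using add_pos z.2 w.2)]
  simp

lemma norm_linearCombination_expLp_sq (c : {z : ℂ // 0 < z.re} →₀ ℂ) :
    ‖Finsupp.linearCombination ℂ expLp c‖ ^ 2 =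
      (∑ i ∈ c.support, ∑ j ∈ c.support, starRingEnd ℂ (c i) * c j *
        (starRingEnd ℂ (i : ℂ) + j)⁻¹).re := by
  rw [← inner_self_eq_norm_sq (𝕜 := ℂ), Finsupp.linearCombination_apply, Finsupp.sum, sum_inner]
  simp only [inner_sum, inner_smul_left, inner_smul_right, inner_expLp]
  refine congrArg Complex.re
    (Finset.sum_congr rfl fun i _ ↦ Finset.sum_congr rfl fun j _ ↦ ?_)
  ring

/-- A function of bounded Hardy norm is represented by a bounded functional on `L²`. -/
lemma HardyBound.exists_dual {f : ℂ → ℂ} {M : ℝ} (hf : HardyBound f M) :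
    ∃ φ : StrongDual ℂ (Lp ℂ 2 (volume.restrict (Iic (0 : ℝ)))), ∀ z, φ (expLp z) = f z := by
  set S := Finsupp.linearCombination ℂ fun z : {z : ℂ // 0 < z.re} ↦ f z
  set T := Finsupp.linearCombination ℂ expLp
  have hST : ∃ C : ℝ, ∀ c, ‖S c‖ ≤ C * ‖T c‖ := by
    refine ⟨√(M / (2 * Real.pi)), fun c ↦ abs_le_of_sq_le_sq' ?_ (by positivity) |>.2⟩
    have h := hf.norm_sum_sq_le c.support c (fun i ↦ (i : ℂ)) fun i _ ↦ i.2
    rw [← norm_linearCombination_expLp_sq] at h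
    rw [mul_pow, Real.sq_sqrt (div_nonneg hf.nonneg (by positivity)), div_mul_eq_mul_div,
      le_div_iff₀ (by positivity), mul_comm]
    exact h
  obtain ⟨φ, hφ, -⟩ := exists_extension_norm_eq _ (S.compLeftInverse T)
  refine ⟨φ, fun z ↦ ?_⟩
  have hT : T (Finsupp.single z 1) = expLp z := by simp [T]
  have h := LinearMap.compLeftInverse_apply_of_bdd S T hST _ _ hT
  rw [← hφ] at h
  simpa [S] using h

lemma hardyBound_of_iSup_lt_top {f : ℂ → ℂ} (hf : DifferentiableOn ℂ f {z : ℂ | 0 < z.re})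
    (hsup : (⨆ u ∈ Set.Ioi (0 : ℝ),
        ∫⁻ v : ℝ, (‖f ((u : ℂ) + (v : ℂ) * Complex.I)‖₊ : ℝ≥0∞) ^ 2) < ⊤) :
    HardyBound f (⨆ u ∈ Set.Ioi (0 : ℝ),
        ∫⁻ v : ℝ, (‖f ((u : ℂ) + (v : ℂ) * Complex.I)‖₊ : ℝ≥0∞) ^ 2).toReal := by
  have hle {u : ℝ} (hu : 0 < u) :=
    le_iSup₂ (f := fun (u : ℝ) (_ : u ∈ Ioi (0 : ℝ)) ↦
      ∫⁻ v : ℝ, (‖f ((u : ℂ) + (v : ℂ) * Complex.I)‖₊ : ℝ≥0∞) ^ 2) u hu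
  have hm {u : ℝ} (hu : 0 < u) :
      AEStronglyMeasurable fun v : ℝ ↦ ‖f (u + v * Complex.I)‖ ^ 2 :=
    ((hf.continuous_line hu).norm.pow 2).aestronglyMeasurable
  refine ⟨hf, fun {u} hu ↦ ⟨hm hu, ?_⟩, fun {u} hu ↦ ?_⟩
  · refine lt_of_eq_of_lt ?_ ((hle hu).trans_lt hsup)
    simp [enorm_eq_nnnorm]
  · rw [integral_eq_lintegral_of_nonneg_ae (.of_forall fun _ ↦ by positivity) (hm hu)]
    refine ENNReal.toReal_mono hsup.ne (le_of_eq_of_le ?_ (hle hu))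
    simp only [ENNReal.ofReal_pow (norm_nonneg _), ofReal_norm, enorm_eq_nnnorm]

theorem paley_wiener_H2_halfplane (f : ℂ → ℂ)
    (hf : DifferentiableOn ℂ f {z : ℂ | 0 < z.re})
    (hsup : (⨆ u ∈ Set.Ioi (0 : ℝ),
        ∫⁻ v : ℝ, (‖f ((u : ℂ) + (v : ℂ) * Complex.I)‖₊ : ℝ≥0∞) ^ 2) < ⊤) :
    ∃ G : ℝ → ℂ, Measurable G ∧
      (∀ᵐ w : ℝ ∂volume, 0 < w → G w = 0) ∧
      (∫⁻ w in Set.Iic (0 : ℝ), (‖G w‖₊ : ℝ≥0∞) ^ 2) < ⊤ ∧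
      ∀ z : ℂ, 0 < z.re →
        f z = (Real.sqrt (2 * Real.pi) : ℂ)⁻¹ *
          ∫ w in Set.Iic (0 : ℝ), Complex.exp (z * (w : ℂ)) * G w := by
  obtain ⟨φ, hφ⟩ := (hardyBound_of_iSup_lt_top hf hsup).exists_dual
  set g := (InnerProductSpace.toDual ℂ _).symm φ
  set H : ℝ → ℂ := fun w ↦ Real.sqrt (2 * Real.pi) * starRingEnd ℂ (g w) with hH
  have hind : ∀ᵐ w ∂volume.restrict (Iic (0 : ℝ)), (Iic 0).indicator H w = H w := by
    filter_upwards [ae_restrict_mem measurableSet_Iic] with w hw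
    exact indicator_of_mem hw _
  refine ⟨(Iic 0).indicator H, Measurable.indicator ?_ measurableSet_Iic,
    .of_forall fun w hw ↦ indicator_of_notMem (by simpa using hw) _, ?_, fun z hz ↦ ?_⟩
  · exact (Complex.measurable_ofReal.comp measurable_const).mul
      (Complex.continuous_conj.measurable.comp (Lp.stronglyMeasurable g).measurable)
  · have hm : MemLp H 2 (volume.restrict (Iic 0)) := ((Lp.memLp g).star).const_mul _
    have h := lintegral_rpow_enorm_lt_top_of_eLpNorm_lt_top two_ne_zero ENNReal.ofNat_ne_top hm.2
    refine lt_of_eq_of_lt (lintegral_congr_ae ?_) h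
    filter_upwards [hind] with w hw
    rw [hw, enorm_eq_nnnorm]
    simp
  · have hs : (Real.sqrt (2 * Real.pi) : ℂ) ≠ 0 := by
      exact_mod_cast (Real.sqrt_pos.2 (by positivity)).ne'
    have h1 : f z = inner ℂ g (expLp ⟨z, hz⟩) := by
      rw [InnerProductSpace.toDual_symm_apply, hφ]
    rw [h1, L2.inner_def, ← integral_const_mul]
    refine integral_congr_ae ?_
    filter_upwards [hind, (memLp_exp_mul hz).coeFn_toLp] with w hw hw'
    rw [hw, expLp, hw', RCLike.inner_apply, hH]
    field_simp
end

section
/- Let G : ℝ → ℂ be measurable with G(w) = 0 for almost every w > 0 and ∫_{-∞}^0 |G(w)|² dw < ∞, and define f(z) = (1/√(2π)) ∫_{-∞}^0 e^{zw} G(w) dw for Re z > 0. Then for every u > 0 one has ∫_ℝ |f(u+iv)|² dv = ∫_{-∞}^0 e^{2uw} |G(w)|² dw. -/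
open MeasureTheory Set
open scoped ENNReal NNReal

section Plancherel

open FourierTransform SchwartzMap
open scoped ContDiff

variable {E F : Type*} [NormedAddCommGroup E] [InnerProductSpace ℝ E] [FiniteDimensional ℝ E]
  [MeasurableSpace E] [BorelSpace E]
  [NormedAddCommGroup F] [InnerProductSpace ℂ F]

lemma MeasureTheory.Integrable.continuous_fourier {f : E → F} (hf : Integrable f) :
    Continuous (𝓕 f) :=
  VectorFourier.fourierIntegral_continuous Real.continuous_fourierChar continuous_inner hf

variable [CompleteSpace F]

/-- On `L¹ ∩ L²` the `L²` Fourier transform is given by the Fourier integral. -/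
lemma MeasureTheory.MemLp.fourier_toLp_ae_eq {f : E → F} (hf : Integrable f)
    (hf2 : MemLp f 2) : (𝓕 (hf2.toLp f) : Lp (α := E) F 2) =ᵐ[volume] 𝓕 f := by
  refine ae_eq_of_integral_contDiff_smul_eq
    ((Lp.memLp _).locallyIntegrable (by norm_num)) hf.continuous_fourier.locallyIntegrable ?_
  intro g hg hgs
  have hgs' : HasCompactSupport (fun x => (g x : ℂ)) :=
    hgs.comp_left (g := fun x : ℝ => (x : ℂ)) Complex.ofReal_zero
  set φ : 𝓢(E, ℂ) := hgs'.toSchwartzMap (Complex.ofRealCLM.contDiff.comp hg) with hφ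
  have hφ' : ∀ x, φ x = (g x : ℂ) := fun x => rfl
  have key := DFunLike.congr_fun (Lp.fourier_toTemperedDistribution_eq (hf2.toLp f)) φ
  rw [TemperedDistribution.fourier_apply, Lp.toTemperedDistribution_apply,
    Lp.toTemperedDistribution_apply] at key
  have h1 : ∫ x, (𝓕 φ) x • (hf2.toLp f) x = ∫ x, (𝓕 φ) x • f x := by
    refine integral_congr_ae ?_
    filter_upwards [hf2.coeFn_toLp] with x hx
    rw [hx]
  have h2 : ∫ x, (𝓕 φ) x • f x = ∫ x, φ x • 𝓕 f x := by
    have := VectorFourier.integral_fourierIntegral_smul_eq_flip (μ := volume) (ν := volume)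
      (L := innerₗ E) Real.continuous_fourierChar continuous_inner φ.integrable hf
    rw [flip_innerₗ] at this
    rw [fourier_coe]
    exact this
  rw [h1, h2] at key
  simpa only [hφ', Complex.coe_smul] using key.symm

/-- Plancherel's theorem for the Fourier integral on `L¹ ∩ L²`. -/
lemma MeasureTheory.MemLp.eLpNorm_fourier_eq {f : E → F} (hf : Integrable f)
    (hf2 : MemLp f 2) : eLpNorm (𝓕 f) 2 volume = eLpNorm f 2 volume := by
  rw [← eLpNorm_congr_ae (hf2.fourier_toLp_ae_eq hf), ← eLpNorm_congr_ae hf2.coeFn_toLp,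
    ← Lp.enorm_def, ← Lp.enorm_def, ← ofReal_norm, ← ofReal_norm, Lp.norm_fourier_eq]

lemma MeasureTheory.MemLp.lintegral_enorm_fourier_sq {f : E → F} (hf : Integrable f)
    (hf2 : MemLp f 2) : ∫⁻ x, ‖𝓕 f x‖ₑ ^ 2 = ∫⁻ x, ‖f x‖ₑ ^ 2 := by
  have h := congrArg (fun t : ℝ≥0∞ => t ^ 2) (hf2.eLpNorm_fourier_eq hf)
  have h' (g : E → F) : eLpNorm g 2 volume ^ 2 = ∫⁻ x, ‖g x‖ₑ ^ 2 := by
    simpa using eLpNorm_nnreal_pow_eq_lintegral (f := g) (μ := volume) (p := 2) two_ne_zero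
  simpa only [h'] using h

end Plancherel

lemma lintegral_comp_mul_left_real (g : ℝ → ℝ≥0∞) {a : ℝ} (ha : a ≠ 0) :
    ∫⁻ x, g (a * x) = ENNReal.ofReal |a⁻¹| * ∫⁻ x, g x := by
  have h := (Homeomorph.mulLeft₀ a ha).measurableEmbedding.lintegral_map (μ := volume) g
  simp only [Homeomorph.coe_mulLeft₀] at h
  rw [← h, Real.map_volume_mul_left ha, lintegral_smul_measure, smul_eq_mul]

lemma memLp_two_exp_mul_Iic {u : ℝ} (hu : 0 < u) :
    MemLp (fun w : ℝ => Complex.exp (u * w)) 2 (volume.restrict (Iic 0)) := by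
  rw [memLp_two_iff_integrable_sq_norm (by fun_prop)]
  refine (integrableOn_exp_mul_Iic (a := 2 * u) (by positivity) 0).congr (.of_forall fun w => ?_)
  simp only [Complex.norm_exp, ← Real.exp_nat_mul]
  simp [mul_assoc]

theorem plancherel_slices_H2_halfplane (G : ℝ → ℂ) (hGm : Measurable G)
    (hG0 : ∀ᵐ w : ℝ ∂volume, 0 < w → G w = 0)
    (hG2 : (∫⁻ w in Set.Iic (0 : ℝ), (‖G w‖₊ : ℝ≥0∞) ^ 2) < ⊤)
    (f : ℂ → ℂ)
    (hf : ∀ z : ℂ, 0 < z.re →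
      f z = (Real.sqrt (2 * Real.pi) : ℂ)⁻¹ *
        ∫ w in Set.Iic (0 : ℝ), Complex.exp (z * (w : ℂ)) * G w) :
    ∀ u : ℝ, 0 < u →
      (∫⁻ v : ℝ, (‖f ((u : ℂ) + (v : ℂ) * Complex.I)‖₊ : ℝ≥0∞) ^ 2) =
        ∫⁻ w in Set.Iic (0 : ℝ),
          ENNReal.ofReal (Real.exp (2 * u * w)) * (‖G w‖₊ : ℝ≥0∞) ^ 2 := by
  intro u hu
  have hπ := Real.pi_pos
  have hG : MemLp G 2 (volume.restrict (Iic 0)) := by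
    refine ⟨hGm.aestronglyMeasurable, ?_⟩
    have h := eLpNorm_nnreal_pow_eq_lintegral (f := G) (μ := volume.restrict (Iic 0))
      (p := 2) two_ne_zero
    rw [← ENNReal.rpow_lt_top_iff_of_pos (y := 2) two_pos]
    simp only [NNReal.coe_ofNat, ENNReal.coe_ofNat, ENNReal.rpow_ofNat] at h ⊢
    rwa [h]
  let K : ℝ → ℂ := fun w => Complex.exp (u * w) * G w
  let H : ℝ → ℂ := (Iic 0).indicator K
  have hH1 : Integrable H :=
    (integrable_indicator_iff measurableSet_Iic).2 ((memLp_two_exp_mul_Iic hu).integrable_mul hG)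
  have hKnorm : ∀ w, ‖K w‖ₑ ^ 2 = ENNReal.ofReal (Real.exp (2 * u * w)) * ‖G w‖ₑ ^ 2 := by
    intro w
    rw [enorm_mul, mul_pow, ← ofReal_norm (Complex.exp _), Complex.norm_exp,
      ← ENNReal.ofReal_pow (Real.exp_pos _).le, ← Real.exp_nat_mul]
    simp [mul_assoc]
  have hH2 : MemLp H 2 := by
    refine (memLp_indicator_iff_restrict measurableSet_Iic).2 ?_
    refine hG.mono (by fun_prop) ?_
    filter_upwards [ae_restrict_mem measurableSet_Iic] with w hw
    rw [norm_mul, Complex.norm_exp]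
    refine mul_le_of_le_one_left (norm_nonneg _) (Real.exp_le_one_iff.2 ?_)
    simpa using mul_nonpos_of_nonneg_of_nonpos hu.le hw
  have hfH : ∀ v : ℝ, f (u + v * Complex.I) =
      (Real.sqrt (2 * Real.pi) : ℂ)⁻¹ * FourierTransform.fourier H (-(2 * Real.pi)⁻¹ * v) := by
    intro v
    rw [hf _ (by simpa using hu), Real.fourier_real_eq_integral_exp_smul]
    rw [← integral_indicator measurableSet_Iic]
    congr 2 with w
    by_cases hw : w ∈ Iic (0 : ℝ)
    · simp only [H, K, indicator_of_mem hw, smul_eq_mul]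
      rw [← mul_assoc, ← Complex.exp_add]
      congr 2
      push_cast
      field_simp
      ring
    · simp [H, indicator_of_notMem hw]
  have hc : ‖(Real.sqrt (2 * Real.pi) : ℂ)⁻¹‖ₑ ^ 2 = ENNReal.ofReal (2 * Real.pi)⁻¹ := by
    rw [← ofReal_norm, ← ENNReal.ofReal_pow (norm_nonneg _), norm_inv, Complex.norm_real,
      inv_pow, Real.norm_eq_abs, sq_abs, Real.sq_sqrt (by positivity)]
  simp only [← enorm_eq_nnnorm, hfH, enorm_mul, mul_pow, hc, ← hKnorm]
  rw [lintegral_const_mul' _ _ ENNReal.ofReal_ne_top,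
    lintegral_comp_mul_left_real (fun x => ‖FourierTransform.fourier H x‖ₑ ^ 2)
      (neg_ne_zero.2 (by positivity)),
    hH2.lintegral_enorm_fourier_sq hH1, ← mul_assoc, ← ENNReal.ofReal_mul (by positivity),
    inv_neg, inv_inv, abs_neg, abs_of_pos (by positivity), inv_mul_cancel₀ (by positivity),
    ENNReal.ofReal_one, one_mul, ← lintegral_indicator measurableSet_Iic]
  congr 1 with w
  by_cases hw : w ∈ Iic (0 : ℝ) <;> simp [H, hw]
end

section
/- Let B > 0 and C > 0, and let f : ℂ → ℂ be an entire function such that |f(z)| ≤ C e^{B|z|} for all z ∈ ℂ and ∫_ℝ |f(u)|² du < ∞. Then there exists a measurable function h : ℝ → ℂ with h(w) = 0 for almost every w with |w| > B, ∫_{-B}^{B} |h(w)|² dw < ∞, and f(z) = (1/√(2π)) ∫_{-B}^{B} e^{izw} h(w) dw for every z ∈ ℂ. -/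
open MeasureTheory Set
open scoped ENNReal NNReal
open Filter Topology

/-- The Laplace transform of a function which becomes integrable on the positive half-line after
multiplication by any decaying exponential is holomorphic on the right half-plane. -/
theorem differentiableOn_laplace {φ : ℝ → ℂ}
    (hφ : ∀ ε : ℝ, 0 < ε → IntegrableOn (fun x : ℝ => φ x * Complex.exp (-(ε * x))) (Ioi 0)) :
    DifferentiableOn ℂ (fun w : ℂ => ∫ x in Ioi (0 : ℝ), φ x * Complex.exp (-(w * x)))
      {w : ℂ | 0 < w.re} := by
  have hmeas : AEStronglyMeasurable φ (volume.restrict (Ioi 0)) := by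
    have h1 := ((hφ 1 one_pos).aestronglyMeasurable).mul
      (Continuous.aestronglyMeasurable (f := fun x : ℝ => Complex.exp x) (by fun_prop))
    refine h1.congr (Eventually.of_forall fun x => ?_)
    change φ x * Complex.exp (-((1 : ℝ) * x)) * Complex.exp x = φ x
    rw [mul_assoc, ← Complex.exp_add, Complex.ofReal_one, one_mul, neg_add_cancel,
      Complex.exp_zero, mul_one]
  have hm : ∀ w : ℂ, AEStronglyMeasurable (fun x : ℝ => φ x * Complex.exp (-(w * x)))
      (volume.restrict (Ioi 0)) := fun w =>
    hmeas.mul (Continuous.aestronglyMeasurable (by fun_prop))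
  have hb : ∀ (w : ℂ) (ε x : ℝ), 0 < x → ε ≤ w.re →
      ‖φ x * Complex.exp (-(w * x))‖ ≤ ‖φ x * Complex.exp (-(ε * x))‖ := by
    intro w ε x hx hw
    rw [norm_mul, norm_mul, Complex.norm_exp, Complex.norm_exp]
    refine mul_le_mul_of_nonneg_left (Real.exp_le_exp.mpr ?_) (norm_nonneg _)
    simp only [Complex.neg_re, Complex.mul_re, Complex.ofReal_re, Complex.ofReal_im]
    nlinarith
  intro w₀ hw₀
  have hw₀' : 0 < w₀.re := hw₀
  set δ := w₀.re / 3 with hδ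
  have hδ0 : 0 < δ := by positivity
  have hs : {w : ℂ | 2 * δ < w.re} ∈ 𝓝 w₀ :=
    (isOpen_lt continuous_const Complex.continuous_re).mem_nhds
      (by simp only [mem_ofPred_eq]; linarith)
  have key := hasDerivAt_integral_of_dominated_loc_of_deriv_le (μ := volume.restrict (Ioi (0:ℝ)))
    (F := fun (w : ℂ) (x : ℝ) => φ x * Complex.exp (-(w * x)))
    (F' := fun (w : ℂ) (x : ℝ) => φ x * Complex.exp (-(w * x)) * (-x))
    (bound := fun x : ℝ => ‖φ x * Complex.exp (-(δ * x))‖ * δ⁻¹) hs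
    (Eventually.of_forall hm)
    ?_ ((hm w₀).mul (Continuous.aestronglyMeasurable (by fun_prop))) ?_ ?_ ?_
  · exact key.2.differentiableAt.differentiableWithinAt
  · refine Integrable.mono (hφ δ hδ0) (hm w₀) ?_
    filter_upwards [ae_restrict_mem measurableSet_Ioi] with x hx
    exact hb w₀ δ x hx (by linarith)
  · filter_upwards [ae_restrict_mem measurableSet_Ioi] with x hx w hw
    have hx : 0 < x := hx
    have hw : 2 * δ < w.re := hw
    have h1 := hb w (2 * δ) x hx hw.le
    rw [norm_mul]
    refine (mul_le_mul_of_nonneg_right h1 (norm_nonneg _)).trans ?_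
    have h2 : x ≤ δ⁻¹ * Real.exp (δ * x) := by
      have := Real.add_one_le_exp (δ * x)
      rw [inv_mul_eq_div, le_div_iff₀ hδ0]
      linarith
    rw [norm_mul, norm_mul, Complex.norm_exp, Complex.norm_exp, norm_neg, Complex.norm_real,
      Real.norm_of_nonneg hx.le, mul_assoc, mul_assoc]
    refine mul_le_mul_of_nonneg_left ?_ (norm_nonneg _)
    have h3 : Real.exp (-(((2 * δ : ℝ) : ℂ) * (x : ℂ))).re
        = Real.exp (-((δ : ℂ) * (x : ℂ))).re * Real.exp (-(δ * x)) := by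
      rw [← Real.exp_add]
      congr 1
      simp
      ring
    rw [h3, mul_assoc]
    gcongr
    calc Real.exp (-(δ * x)) * x ≤ Real.exp (-(δ * x)) * (δ⁻¹ * Real.exp (δ * x)) := by gcongr
      _ = δ⁻¹ := by rw [mul_left_comm, ← Real.exp_add]; simp
  · exact (hφ δ hδ0).norm.mul_const _
  · refine Eventually.of_forall fun x w _ => ?_
    have h1 : HasDerivAt (fun w : ℂ => -(w * (x : ℂ))) (-(x : ℂ)) w := by
      simpa using (hasDerivAt_mul_const (x : ℂ) (x := w)).fun_neg
    simpa [mul_assoc] using (h1.cexp.const_mul (φ x))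

/-- An entire function of exponential type is integrable along a ray `s ↦ c * s`, `‖c‖ = 1`,
after multiplication by a sufficiently fast decaying exponential. -/
theorem integrableOn_Ioi_of_exponential_type {B C : ℝ} {f : ℂ → ℂ} (hf : Continuous f)
    (hgrowth : ∀ z : ℂ, ‖f z‖ ≤ C * Real.exp (B * ‖z‖)) {c w : ℂ} (hc : ‖c‖ = 1)
    (hw : B < w.re) :
    IntegrableOn (fun s : ℝ => f (c * s) * Complex.exp (-(w * s))) (Ioi 0) := by
  have h0 : IntegrableOn (fun s : ℝ => C * Real.exp (-(w.re - B) * s)) (Ioi 0) :=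
    (exp_neg_integrableOn_Ioi 0 (by linarith)).const_mul C
  refine h0.mono' (Continuous.aestronglyMeasurable (by fun_prop)) ?_
  filter_upwards [ae_restrict_mem measurableSet_Ioi] with s hs
  have hs : 0 < s := hs
  rw [norm_mul, Complex.norm_exp]
  have h1 := hgrowth (c * s)
  rw [norm_mul, hc, Complex.norm_real, Real.norm_of_nonneg hs.le, one_mul] at h1
  refine (mul_le_mul_of_nonneg_right h1 (Real.exp_pos _).le).trans_eq ?_
  rw [mul_assoc, ← Real.exp_add]
  congr 2
  simp
  ring

/-- The Laplace integral of an entire function of exponential type `B` may be computed along an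
imaginary half-axis, if both integrals are dominated by the type. -/
theorem laplace_eq_rotate_of_re_gt {B C : ℝ} (hC : 0 < C) (hB : 0 < B) {f : ℂ → ℂ}
    (hf : Differentiable ℂ f)
    (hgrowth : ∀ z : ℂ, ‖f z‖ ≤ C * Real.exp (B * ‖z‖)) {σ : ℝ} (hσ : σ = 1 ∨ σ = -1) {w : ℂ}
    (hre : B < w.re) (him : B < -(σ * w.im)) :
    ∫ x in Ioi (0 : ℝ), f x * Complex.exp (-(w * x)) =
      σ * Complex.I * ∫ s in Ioi (0 : ℝ), f (σ * Complex.I * s) *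
        Complex.exp (-((w * (σ * Complex.I)) * s)) := by
  have hσ1 : |σ| = 1 := by rcases hσ with rfl | rfl <;> norm_num
  have hi1 := integrableOn_Ioi_of_exponential_type hf.continuous hgrowth (c := 1) (w := w)
    (by simp) hre
  have hi2 := integrableOn_Ioi_of_exponential_type hf.continuous hgrowth (c := σ * Complex.I)
    (w := w * (σ * Complex.I)) (by simp [hσ1]) (by simp; linarith)
  simp only [one_mul] at hi1
  have ht1 := intervalIntegral_tendsto_integral_Ioi 0 hi1 tendsto_id
  have ht2 := (intervalIntegral_tendsto_integral_Ioi 0 hi2 tendsto_id).const_mul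
    ((σ : ℂ) * Complex.I)
  set δ := min (w.re - B) (-(σ * w.im) - B)
  have hδ0 : 0 < δ := lt_min (by linarith) (by linarith)
  have hδ1 : δ ≤ w.re - B := min_le_left _ _
  have hδ2 : δ ≤ -(σ * w.im) - B := min_le_right _ _
  have hbound : ∀ x s : ℝ, 0 ≤ x → 0 ≤ s →
      ‖f (x + (σ * s : ℝ) * Complex.I) * Complex.exp (-(w * (x + (σ * s : ℝ) * Complex.I)))‖
        ≤ C * Real.exp (-(δ * (x + s))) := by
    intro x s hx hs
    have h1 := hgrowth (x + (σ * s : ℝ) * Complex.I)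
    have h2 : ‖(x + (σ * s : ℝ) * Complex.I : ℂ)‖ ≤ x + s := by
      refine (norm_add_le _ _).trans_eq ?_
      simp [hσ1, abs_of_nonneg hx, abs_of_nonneg hs]
    rw [norm_mul, Complex.norm_exp]
    calc _ ≤ (C * Real.exp (B * (x + s))) * _ := by
          gcongr
          exact h1.trans (by gcongr)
      _ ≤ _ := by
          rw [mul_assoc, ← Real.exp_add]
          gcongr
          simp
          nlinarith
  have hlim : Tendsto (fun R : ℝ => 2 * (C * (R * Real.exp (-(δ * R))))) atTop (𝓝 0) := by
    have := (Real.tendsto_pow_mul_exp_neg_atTop_nhds_zero 1).comp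
      (tendsto_id.const_mul_atTop hδ0)
    have := (this.const_mul (2 * C * δ⁻¹))
    rw [mul_zero] at this
    refine this.congr fun R => ?_
    simp
    field_simp
  have hdiff : Tendsto (fun R : ℝ => (∫ x in (0:ℝ)..R, f x * Complex.exp (-(w * x))) -
      σ * Complex.I * ∫ s in (0:ℝ)..R, f (σ * Complex.I * s) *
        Complex.exp (-((w * (σ * Complex.I)) * s))) atTop (𝓝 0) := by
    refine squeeze_zero_norm' ?_ hlim
    filter_upwards [eventually_ge_atTop 0] with R hR
    have hrect := Complex.integral_boundary_rect_eq_zero_of_differentiableOn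
      (fun z => f z * Complex.exp (-(w * z))) 0 (R + (σ * R : ℝ) * Complex.I)
      (by fun_prop)
    have hre' : (R + (σ * R : ℝ) * Complex.I : ℂ).re = R := by simp
    have him' : (R + (σ * R : ℝ) * Complex.I : ℂ).im = σ * R := by simp
    simp only [hre', him', Complex.zero_re, Complex.zero_im, Complex.ofReal_zero, zero_mul,
      add_zero, zero_add, smul_eq_mul] at hrect
    have hA : ‖∫ x in (0:ℝ)..R, f (x + (σ * R : ℝ) * Complex.I) *
        Complex.exp (-(w * (x + (σ * R : ℝ) * Complex.I)))‖ ≤ C * (R * Real.exp (-(δ * R))) := by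
      refine (intervalIntegral.norm_integral_le_of_norm_le_const
        (C := C * Real.exp (-(δ * R))) fun x hx => ?_).trans_eq ?_
      · rw [uIoc_of_le hR] at hx
        refine (hbound x R hx.1.le hR).trans ?_
        gcongr
        linarith [hx.1]
      · rw [sub_zero, abs_of_nonneg hR]; ring
    have hsub : ∀ g : ℝ → ℂ, ∫ y in (0:ℝ)..(σ * R), g y = σ * ∫ s in (0:ℝ)..R, g (σ * s) := by
      intro g
      have := intervalIntegral.smul_integral_comp_mul_left (a := 0) (b := R) g σ
      rw [mul_zero] at this
      rw [← this, Complex.real_smul]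
    have hD : ‖∫ y in (0:ℝ)..(σ * R), f (R + y * Complex.I) *
        Complex.exp (-(w * (R + y * Complex.I)))‖ ≤ C * (R * Real.exp (-(δ * R))) := by
      rw [hsub, norm_mul, Complex.norm_real, Real.norm_eq_abs, hσ1, one_mul]
      refine (intervalIntegral.norm_integral_le_of_norm_le_const
        (C := C * Real.exp (-(δ * R))) fun x hx => ?_).trans_eq ?_
      · rw [uIoc_of_le hR] at hx
        refine (hbound R x hR hx.1.le).trans ?_
        gcongr
        linarith [hx.1]
      · rw [sub_zero, abs_of_nonneg hR]; ring
    have hE : Complex.I * ∫ y in (0:ℝ)..(σ * R), f (y * Complex.I) *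
        Complex.exp (-(w * (y * Complex.I))) = σ * Complex.I * ∫ s in (0:ℝ)..R,
          f (σ * Complex.I * s) * Complex.exp (-((w * (σ * Complex.I)) * s)) := by
      rw [hsub, ← mul_assoc, mul_comm Complex.I]
      congr 1
      refine intervalIntegral.integral_congr fun s _ => ?_
      simp only [Complex.ofReal_mul]
      rw [show (σ * s * Complex.I : ℂ) = σ * Complex.I * s by ring, mul_assoc w]
    rw [hE] at hrect
    rw [show ∀ a b c d : ℂ, a - d = (a - b + c - d) + (b - c) from fun _ _ _ _ => by ring, hrect,
      zero_add]
    refine (norm_sub_le _ _).trans ?_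
    rw [norm_mul, Complex.norm_I, one_mul]
    linarith
  exact sub_eq_zero.mp (tendsto_nhds_unique (ht1.sub ht2) hdiff)

/-- If the Laplace integral of an entire function `f` of exponential type converges in the right
half-plane, it may be computed along an imaginary half-axis. -/
theorem laplace_eq_rotate {B C : ℝ} (hC : 0 < C) (hB : 0 < B) {f : ℂ → ℂ}
    (hf : Differentiable ℂ f)
    (hgrowth : ∀ z : ℂ, ‖f z‖ ≤ C * Real.exp (B * ‖z‖))
    (hint : ∀ ε : ℝ, 0 < ε → IntegrableOn (fun x : ℝ => f x * Complex.exp (-(ε * x))) (Ioi 0))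
    {σ : ℝ} (hσ : σ = 1 ∨ σ = -1) {w : ℂ} (hre : 0 < w.re) (him : B < -(σ * w.im)) :
    ∫ x in Ioi (0 : ℝ), f x * Complex.exp (-(w * x)) =
      σ * Complex.I * ∫ s in Ioi (0 : ℝ), f (σ * Complex.I * s) *
        Complex.exp (-((w * (σ * Complex.I)) * s)) := by
  have hσσ : σ * σ = 1 := by rcases hσ with rfl | rfl <;> norm_num
  have hσ1 : |σ| = 1 := by rcases hσ with rfl | rfl <;> norm_num
  set U : Set ℂ := {w : ℂ | 0 < w.re} ∩ {w : ℂ | w.im * σ < -B}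
  have hUo : IsOpen U := (isOpen_lt continuous_const Complex.continuous_re).inter
    (isOpen_lt (Complex.continuous_im.mul continuous_const) continuous_const)
  have hUc : IsPreconnected U := by
    refine ((convex_halfSpace_re_gt 0).inter ?_).isPreconnected
    refine convex_halfSpace_lt (f := fun w : ℂ => w.im * σ) ⟨?_, ?_⟩ (-B)
    · intro x y; simp; ring
    · intro c x; simp; ring
  have hL : DifferentiableOn ℂ
      (fun w : ℂ => ∫ x in Ioi (0 : ℝ), f x * Complex.exp (-(w * x))) U :=
    (differentiableOn_laplace hint).mono inter_subset_left
  have hR : DifferentiableOn ℂ (fun w : ℂ => σ * Complex.I * ∫ s in Ioi (0 : ℝ),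
      f (σ * Complex.I * s) * Complex.exp (-((w * (σ * Complex.I)) * s))) U := by
    have h1 := differentiableOn_laplace
      (φ := fun s : ℝ => f (σ * Complex.I * s) * Complex.exp (-(B * s))) (fun ε hε => by
        have := integrableOn_Ioi_of_exponential_type hf.continuous hgrowth (c := σ * Complex.I)
          (w := B + ε) (by simp [hσ1]) (by simp; linarith)
        refine this.congr_fun (fun s _ => ?_) measurableSet_Ioi
        simp only
        rw [mul_assoc (f _), ← Complex.exp_add]
        congr 2
        ring)
    have h2 := h1.comp (f := fun w : ℂ => w * (σ * Complex.I) - B) (s := U) (by fun_prop)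
      (fun w hw => by
        have hw2 : w.im * σ < -B := hw.2
        simp only [mem_ofPred_eq]
        simp
        linarith)
    refine (h2.const_mul (σ * Complex.I)).congr fun w _ => ?_
    simp only [Function.comp]
    congr 1
    refine integral_congr_ae (Eventually.of_forall fun s => ?_)
    simp only
    rw [mul_assoc (f _), ← Complex.exp_add]
    congr 2
    ring
  have hz : ((B + 1 : ℝ) - σ * (B + 1 : ℝ) * Complex.I : ℂ) ∈
      ({w : ℂ | B < w.re} ∩ {w : ℂ | w.im * σ < -B}) := by
    constructor
    · simp only [mem_ofPred_eq]; simp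
    · simp only [mem_ofPred_eq]; simp; nlinarith
  have hV : IsOpen ({w : ℂ | B < w.re} ∩ {w : ℂ | w.im * σ < -B}) :=
    (isOpen_lt continuous_const Complex.continuous_re).inter
    (isOpen_lt (Complex.continuous_im.mul continuous_const) continuous_const)
  refine (hL.analyticOnNhd hUo).eqOn_of_preconnected_of_eventuallyEq (hR.analyticOnNhd hUo) hUc
    (z₀ := ((B + 1 : ℝ) - σ * (B + 1 : ℝ) * Complex.I : ℂ)) ⟨hB.trans hz.1, hz.2⟩ ?_
    ⟨hre, show w.im * σ < -B by linarith⟩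
  filter_upwards [hV.mem_nhds hz] with v hv
  have hv2 : v.im * σ < -B := hv.2
  exact laplace_eq_rotate_of_re_gt hC hB hf hgrowth hσ hv.1 (by linarith)

theorem memLp_exp_neg_mul_abs {ε : ℝ} (hε : 0 < ε) :
    MemLp (fun x : ℝ => Complex.exp (-(ε * |x|))) 2 := by
  rw [memLp_two_iff_integrable_sq_norm (Continuous.aestronglyMeasurable (by fun_prop))]
  have h : ∀ x : ℝ, ‖Complex.exp (-(ε * |x|))‖ ^ 2 = Real.exp (-(2 * ε) * |x|) := by
    intro x
    rw [Complex.norm_exp, ← Real.exp_nat_mul]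
    congr 1
    simp
    ring
  simp_rw [h]
  rw [← integrableOn_univ, ← Iic_union_Ioi (a := (0 : ℝ))]
  refine IntegrableOn.union ?_ ?_
  · refine (integrableOn_exp_mul_Iic (a := 2 * ε) (by positivity) 0).congr_fun (fun x hx => ?_)
      measurableSet_Iic
    simp only [abs_of_nonpos (mem_Iic.mp hx)]
    ring_nf
  · refine (exp_neg_integrableOn_Ioi 0 (b := 2 * ε) (by positivity)).congr_fun (fun x hx => ?_)
      measurableSet_Ioi
    simp only [abs_of_pos (mem_Ioi.mp hx)]

open FourierTransform in
/-- The Fourier transform of an exponentially damped function of exponential type, at a frequency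
exceeding the type, as an integral over an imaginary half-axis. -/
theorem fourier_mul_exp_neg_mul_abs {B C : ℝ} (hC : 0 < C) (hB : 0 < B) {f : ℂ → ℂ}
    (hf : Differentiable ℂ f)
    (hgrowth : ∀ z : ℂ, ‖f z‖ ≤ C * Real.exp (B * ‖z‖))
    (hL2 : MemLp (fun x : ℝ => f x) 2)
    {σ : ℝ} (hσ : σ = 1 ∨ σ = -1) {ξ : ℝ} (hξ : B < -(σ * (2 * Real.pi * ξ)))
    {ε : ℝ} (hε : 0 < ε) :
    𝓕 (fun x : ℝ => f x * Complex.exp (-(ε * |x|))) ξ =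
      σ * Complex.I * ∫ s in Ioi (0 : ℝ), f (σ * Complex.I * s) *
        Complex.exp (σ * (2 * Real.pi * ξ) * s) *
          (Complex.exp (-(ε * (σ * Complex.I) * s)) - Complex.exp (ε * (σ * Complex.I) * s)) := by
  have hσ1 : |σ| = 1 := by rcases hσ with rfl | rfl <;> norm_num
  have hI : ∀ ε : ℝ, 0 < ε → Integrable (fun x : ℝ => f x * Complex.exp (-(ε * |x|))) :=
    fun ε hε => hL2.integrable_mul (memLp_exp_neg_mul_abs hε)
  have hint : ∀ ε : ℝ, 0 < ε →
      IntegrableOn (fun x : ℝ => f x * Complex.exp (-(ε * x))) (Ioi 0) := by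
    refine fun ε hε => (hI ε hε).integrableOn.congr_fun (fun x hx => ?_) measurableSet_Ioi
    simp only [abs_of_pos (mem_Ioi.mp hx)]
  have hint' : ∀ ε : ℝ, 0 < ε →
      IntegrableOn (fun x : ℝ => f (-x) * Complex.exp (-(ε * x))) (Ioi 0) := by
    refine fun ε hε => (hI ε hε).comp_neg.integrableOn.congr_fun (fun x hx => ?_) measurableSet_Ioi
    simp only [abs_neg, abs_of_pos (mem_Ioi.mp hx), Complex.ofReal_neg]
  have hR := laplace_eq_rotate hC hB hf hgrowth hint hσ (w := ε + (2 * Real.pi * ξ : ℝ) * Complex.I)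
    (by simpa using hε) (by simpa using hξ)
  have hL := laplace_eq_rotate hC hB (f := fun z => f (-z)) (hf.comp differentiable_neg)
    (fun z => by simpa using hgrowth (-z)) hint' (σ := -σ)
    (by rcases hσ with rfl | rfl <;> simp)
    (w := ε - (2 * Real.pi * ξ : ℝ) * Complex.I)
    (by simpa using hε) (by simpa using hξ)
  rw [Real.fourier_real_eq_integral_exp_smul]
  simp only [smul_eq_mul]
  have hIξ : Integrable (fun x : ℝ => Complex.exp (↑(-2 * Real.pi * x * ξ) * Complex.I) *
      (f x * Complex.exp (-(ε * |x|)))) := by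
    refine (hI ε hε).bdd_mul (c := 1) (Continuous.aestronglyMeasurable (by fun_prop))
      (Eventually.of_forall fun x => ?_)
    rw [Complex.norm_exp_ofReal_mul_I]
  rw [← intervalIntegral.integral_Iic_add_Ioi (b := 0) hIξ.integrableOn hIξ.integrableOn]
  have e1 : ∫ x in Ioi (0 : ℝ), Complex.exp (↑(-2 * Real.pi * x * ξ) * Complex.I) *
      (f x * Complex.exp (-(ε * |x|))) = ∫ x in Ioi (0 : ℝ), f x *
        Complex.exp (-((ε + (2 * Real.pi * ξ : ℝ) * Complex.I) * x)) := by
    refine setIntegral_congr_fun measurableSet_Ioi fun x hx => ?_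
    simp only [abs_of_pos (mem_Ioi.mp hx)]
    rw [mul_left_comm, ← Complex.exp_add]
    congr 2
    push_cast
    ring
  have e2 : ∫ x in Iic (0 : ℝ), Complex.exp (↑(-2 * Real.pi * x * ξ) * Complex.I) *
      (f x * Complex.exp (-(ε * |x|))) = ∫ x in Ioi (0 : ℝ), f (-x) *
        Complex.exp (-((ε - (2 * Real.pi * ξ : ℝ) * Complex.I) * x)) := by
    rw [← neg_zero, ← integral_comp_neg_Ioi, neg_zero]
    refine setIntegral_congr_fun measurableSet_Ioi fun x hx => ?_
    simp only [abs_neg, abs_of_pos (mem_Ioi.mp hx)]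
    rw [mul_left_comm, ← Complex.exp_add, Complex.ofReal_neg]
    congr 2
    push_cast
    ring
  rw [e1, e2, hR, hL, Complex.ofReal_neg, neg_mul, neg_mul, add_comm, ← sub_eq_add_neg, ← mul_sub,
    ← integral_sub]
  · congr 1
    refine integral_congr_ae (Eventually.of_forall fun s => ?_)
    simp only [neg_mul, neg_neg]
    have hI2 : Complex.I * Complex.I = -1 := Complex.I_mul_I
    rw [mul_sub, mul_assoc (f _), mul_assoc (f _), ← Complex.exp_add, ← Complex.exp_add]
    congr 3 <;> push_cast <;> linear_combination (-2 * Real.pi * ξ * σ * s : ℂ) * hI2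
  · exact integrableOn_Ioi_of_exponential_type hf.continuous hgrowth (by simp [hσ1])
      (by simp; linarith)
  · have := integrableOn_Ioi_of_exponential_type (f := fun z => f (-z)) (c := -σ * Complex.I)
      (w := (ε - (2 * Real.pi * ξ : ℝ) * Complex.I) * (-σ * Complex.I))
      (hf.continuous.comp continuous_neg)
      (fun z => by simpa using hgrowth (-z)) (by simp [hσ1])
      (by simp; linarith)
    simpa [IntegrableOn] using this

theorem norm_imaginary_axis_integrand_le {B B' C : ℝ} (hC : 0 < C) {f : ℂ → ℂ}
    (hgrowth : ∀ z : ℂ, ‖f z‖ ≤ C * Real.exp (B * ‖z‖))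
    {σ : ℝ} (hσ : σ = 1 ∨ σ = -1) {ξ : ℝ} (hξ : B' < -(σ * (2 * Real.pi * ξ)))
    (ε : ℝ) {s : ℝ} (hs : 0 < s) :
    ‖f (σ * Complex.I * s) * Complex.exp (σ * (2 * Real.pi * ξ) * s) *
      (Complex.exp (-(ε * (σ * Complex.I) * s)) - Complex.exp (ε * (σ * Complex.I) * s))‖
      ≤ C * Real.exp (-(B' - B) * s) * 2 := by
  have hσ1 : |σ| = 1 := by rcases hσ with rfl | rfl <;> norm_num
  rw [norm_mul, norm_mul]
  have h1 : ‖f (σ * Complex.I * s)‖ ≤ C * Real.exp (B * s) := by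
    have := hgrowth (σ * Complex.I * s)
    simpa [hσ1, abs_of_pos hs] using this
  have h2 : ‖Complex.exp (σ * (2 * Real.pi * ξ) * s)‖ ≤ Real.exp (-B' * s) := by
    rw [Complex.norm_exp]
    refine Real.exp_le_exp.mpr ?_
    simp
    nlinarith
  have h3 : ‖Complex.exp (-(ε * (σ * Complex.I) * s)) - Complex.exp (ε * (σ * Complex.I) * s)‖
      ≤ 2 := by
    refine (norm_sub_le _ _).trans ?_
    rw [Complex.norm_exp, Complex.norm_exp]
    simp
    norm_num
  have h4 : C * Real.exp (-(B' - B) * s) = C * Real.exp (B * s) * Real.exp (-B' * s) := by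
    rw [mul_assoc, ← Real.exp_add]
    ring_nf
  rw [h4]
  gcongr

open FourierTransform in
theorem norm_fourier_mul_exp_neg_mul_abs_le {B B' C : ℝ} (hC : 0 < C) (hB : 0 < B) (hB' : B < B')
    {f : ℂ → ℂ} (hf : Differentiable ℂ f)
    (hgrowth : ∀ z : ℂ, ‖f z‖ ≤ C * Real.exp (B * ‖z‖))
    (hL2 : MemLp (fun x : ℝ => f x) 2)
    {σ : ℝ} (hσ : σ = 1 ∨ σ = -1) {ξ : ℝ} (hξ : B' < -(σ * (2 * Real.pi * ξ)))
    {ε : ℝ} (hε : 0 < ε) :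
    ‖𝓕 (fun x : ℝ => f x * Complex.exp (-(ε * |x|))) ξ‖ ≤
      ∫ s in Ioi (0 : ℝ), C * Real.exp (-(B' - B) * s) * 2 := by
  have hσ1 : |σ| = 1 := by rcases hσ with rfl | rfl <;> norm_num
  rw [fourier_mul_exp_neg_mul_abs hC hB hf hgrowth hL2 hσ (hB'.trans hξ) hε, norm_mul, norm_mul,
    Complex.norm_I, Complex.norm_real, Real.norm_eq_abs, hσ1, one_mul, one_mul]
  refine norm_integral_le_of_norm_le
    (((exp_neg_integrableOn_Ioi 0 (by linarith)).const_mul C).mul_const 2) ?_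
  filter_upwards [ae_restrict_mem measurableSet_Ioi] with s hs
  exact norm_imaginary_axis_integrand_le hC hgrowth hσ hξ ε hs

open FourierTransform in
theorem tendsto_fourier_mul_exp_neg_mul_abs {B C : ℝ} (hC : 0 < C) (hB : 0 < B)
    {f : ℂ → ℂ} (hf : Differentiable ℂ f)
    (hgrowth : ∀ z : ℂ, ‖f z‖ ≤ C * Real.exp (B * ‖z‖))
    (hL2 : MemLp (fun x : ℝ => f x) 2)
    {σ : ℝ} (hσ : σ = 1 ∨ σ = -1) {ξ : ℝ} (hξ : B < -(σ * (2 * Real.pi * ξ))) :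
    Tendsto (fun ε : ℝ => 𝓕 (fun x : ℝ => f x * Complex.exp (-(ε * |x|))) ξ) (𝓝[>] 0) (𝓝 0) := by
  obtain ⟨B', hB', hξ'⟩ := exists_between hξ
  have h0 : Tendsto (fun ε : ℝ => σ * Complex.I * ∫ s in Ioi (0 : ℝ), f (σ * Complex.I * s) *
        Complex.exp (σ * (2 * Real.pi * ξ) * s) *
          (Complex.exp (-(ε * (σ * Complex.I) * s)) - Complex.exp (ε * (σ * Complex.I) * s)))
      (𝓝[>] 0) (𝓝 (σ * Complex.I * ∫ s in Ioi (0 : ℝ), (0 : ℂ))) := by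
    refine Tendsto.const_mul _ ?_
    refine tendsto_integral_filter_of_dominated_convergence
      (fun s : ℝ => C * Real.exp (-(B' - B) * s) * 2) ?_ ?_
      (((exp_neg_integrableOn_Ioi 0 (by linarith)).const_mul C).mul_const 2) ?_
    · have := hf.continuous
      exact Eventually.of_forall fun ε => Continuous.aestronglyMeasurable (by fun_prop)
    · refine Eventually.of_forall fun ε => ?_
      filter_upwards [ae_restrict_mem measurableSet_Ioi] with s hs
      exact norm_imaginary_axis_integrand_le hC hgrowth hσ hξ' ε hs
    · refine Eventually.of_forall fun s => ?_
      have : Continuous fun ε : ℝ => f (σ * Complex.I * s) *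
        Complex.exp (σ * (2 * Real.pi * ξ) * s) *
          (Complex.exp (-(ε * (σ * Complex.I) * s)) - Complex.exp (ε * (σ * Complex.I) * s)) := by
        fun_prop
      have h := (this.tendsto 0).mono_left (nhdsWithin_le_nhds (s := Ioi 0))
      simpa using h
  rw [integral_zero, mul_zero] at h0
  refine h0.congr' ?_
  filter_upwards [self_mem_nhdsWithin] with ε hε
  exact (fourier_mul_exp_neg_mul_abs hC hB hf hgrowth hL2 hσ hξ hε).symm

theorem exists_sign_of_lt_abs {B ξ : ℝ} (hξ : B < 2 * Real.pi * |ξ|) :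
    ∃ σ : ℝ, (σ = 1 ∨ σ = -1) ∧ B < -(σ * (2 * Real.pi * ξ)) := by
  rcases le_total 0 ξ with h | h
  · exact ⟨-1, Or.inr rfl, by rw [abs_of_nonneg h] at hξ; linarith⟩
  · exact ⟨1, Or.inl rfl, by rw [abs_of_nonpos h] at hξ; linarith⟩

open FourierTransform in
/-- The Fourier transform is self-adjoint, for a Schwartz function and an integrable function. -/
theorem SchwartzMap.integral_fourier_mul_eq_of_integrable (φ : SchwartzMap ℝ ℂ) {g : ℝ → ℂ}
    (hg : Integrable g) : ∫ x, (𝓕 φ) x * g x = ∫ ξ, φ ξ * 𝓕 g ξ := by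
  simpa using! VectorFourier.integral_fourierIntegral_smul_eq_flip (L := innerₗ ℝ)
    Real.continuous_fourierChar continuous_inner φ.integrable hg

theorem tendsto_integral_mul_mul_exp_neg_mul_abs (ψ : SchwartzMap ℝ ℂ) {f : ℝ → ℂ}
    (hf : Continuous f) (hL2 : MemLp f 2) :
    Tendsto (fun ε : ℝ => ∫ x : ℝ, ψ x * (f x * Complex.exp (-(ε * |x|))))
      (𝓝[>] 0) (𝓝 (∫ x : ℝ, ψ x * f x)) := by
  have hi : Integrable (fun x : ℝ => ψ x * f x) := (ψ.memLp 2 volume).integrable_mul hL2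
  refine tendsto_integral_filter_of_dominated_convergence (fun x : ℝ => ‖ψ x * f x‖)
    ?_ ?_ hi.norm ?_
  · have := ψ.continuous
    exact Eventually.of_forall fun ε => Continuous.aestronglyMeasurable (by fun_prop)
  · filter_upwards [self_mem_nhdsWithin] with ε hε
    refine Eventually.of_forall fun x => ?_
    rw [← mul_assoc, norm_mul _ (Complex.exp _), Complex.norm_exp]
    refine mul_le_of_le_one_right (norm_nonneg _) (Real.exp_le_one_iff.mpr ?_)
    have : 0 ≤ ε * |x| := mul_nonneg (le_of_lt hε) (abs_nonneg x)
    simpa using this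
  · refine Eventually.of_forall fun x => ?_
    have : Continuous fun ε : ℝ => ψ x * (f x * Complex.exp (-(ε * |x|))) := by fun_prop
    have h := (this.tendsto 0).mono_left (nhdsWithin_le_nhds (s := Ioi 0))
    simpa using h

open FourierTransform ContDiff in
theorem fourier_ae_eq_zero_of_lt {B B' C : ℝ} (hC : 0 < C) (hB : 0 < B) (hB' : B < B')
    {f : ℂ → ℂ} (hf : Differentiable ℂ f)
    (hgrowth : ∀ z : ℂ, ‖f z‖ ≤ C * Real.exp (B * ‖z‖))
    (hL2 : MemLp (fun x : ℝ => f x) 2) :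
    ∀ᵐ ξ : ℝ, ξ ∈ {ξ : ℝ | B' < 2 * Real.pi * |ξ|} →
      (𝓕 (hL2.toLp _) : Lp ℂ 2 (volume : Measure ℝ)) ξ = 0 := by
  refine IsOpen.ae_eq_zero_of_integral_contDiff_smul_eq_zero
    (isOpen_lt continuous_const (by fun_prop))
    (((Lp.memLp _).locallyIntegrable one_le_two).locallyIntegrableOn _) ?_
  intro g hg hgc hgs
  have hg₁ : HasCompactSupport (Complex.ofRealCLM ∘ g) := hgc.comp_left rfl
  have hg₂ : ContDiff ℝ ∞ (Complex.ofRealCLM ∘ g) := by fun_prop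
  obtain ⟨φ, hφg⟩ : ∃ φ : SchwartzMap ℝ ℂ, ∀ ξ, φ ξ = g ξ :=
    ⟨hg₁.toSchwartzMap hg₂, fun ξ => rfl⟩
  have hI : ∀ ε : ℝ, 0 < ε → Integrable (fun x : ℝ => f x * Complex.exp (-(ε * |x|))) :=
    fun ε hε => hL2.integrable_mul (memLp_exp_neg_mul_abs hε)
  have h1 : ∫ ξ, g ξ • (𝓕 (hL2.toLp _) : Lp ℂ 2 (volume : Measure ℝ)) ξ = ∫ x : ℝ, (𝓕 φ) x * f x := by
    have h := congrArg (fun T => T φ) (Lp.fourier_toTemperedDistribution_eq (hL2.toLp _))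
    simp only [TemperedDistribution.fourier_apply, Lp.toTemperedDistribution_apply] at h
    calc _ = ∫ ξ, φ ξ • (𝓕 (hL2.toLp _) : Lp ℂ 2 (volume : Measure ℝ)) ξ := by simp [hφg]
      _ = _ := h.symm
      _ = _ := by
        refine integral_congr_ae ?_
        filter_upwards [hL2.coeFn_toLp] with x hx
        rw [hx, smul_eq_mul]
  have h2 := tendsto_integral_mul_mul_exp_neg_mul_abs (𝓕 φ)
    (hf.continuous.comp Complex.continuous_ofReal) hL2
  have h3 : Tendsto (fun ε : ℝ => ∫ ξ : ℝ, φ ξ *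
      𝓕 (fun x : ℝ => f x * Complex.exp (-(ε * |x|))) ξ) (𝓝[>] 0) (𝓝 (∫ ξ : ℝ, (0 : ℂ))) := by
    have hsupp : ∀ ξ, φ ξ ≠ 0 → B' < 2 * Real.pi * |ξ| := by
      intro ξ hξ
      refine hgs (subset_tsupport _ ?_)
      rw [hφg] at hξ
      exact_mod_cast hξ
    refine tendsto_integral_filter_of_dominated_convergence
      (fun ξ : ℝ => ‖φ ξ‖ * ∫ s in Ioi (0 : ℝ), C * Real.exp (-(B' - B) * s) * 2)
      ?_ ?_ (φ.integrable.norm.mul_const _) ?_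
    · filter_upwards [self_mem_nhdsWithin] with ε hε
      exact φ.continuous.aestronglyMeasurable.mul
        (VectorFourier.fourierIntegral_continuous (L := innerₗ ℝ) Real.continuous_fourierChar
          continuous_inner (hI ε hε)).aestronglyMeasurable
    · filter_upwards [self_mem_nhdsWithin] with ε hε
      refine Eventually.of_forall fun ξ => ?_
      rw [norm_mul]
      by_cases hξ : φ ξ = 0
      · simp [hξ]
      · obtain ⟨σ, hσ, hσξ⟩ := exists_sign_of_lt_abs (hsupp ξ hξ)
        gcongr
        exact norm_fourier_mul_exp_neg_mul_abs_le hC hB hB' hf hgrowth hL2 hσ hσξ hε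
    · refine Eventually.of_forall fun ξ => ?_
      by_cases hξ : φ ξ = 0
      · simp [hξ]
      · obtain ⟨σ, hσ, hσξ⟩ := exists_sign_of_lt_abs (hsupp ξ hξ)
        simpa using (tendsto_fourier_mul_exp_neg_mul_abs hC hB hf hgrowth hL2 hσ
          (hB'.trans hσξ)).const_mul (φ ξ)
  rw [integral_zero] at h3
  rw [h1]
  refine tendsto_nhds_unique h2 (h3.congr' ?_)
  filter_upwards [self_mem_nhdsWithin] with ε hε
  exact (φ.integral_fourier_mul_eq_of_integrable (hI ε hε)).symm

open FourierTransform in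
/-- The Fourier transform of a square-integrable function of exponential type `B` vanishes at the
frequencies which exceed `B`. -/
theorem fourier_ae_eq_zero {B C : ℝ} (hC : 0 < C) (hB : 0 < B)
    {f : ℂ → ℂ} (hf : Differentiable ℂ f)
    (hgrowth : ∀ z : ℂ, ‖f z‖ ≤ C * Real.exp (B * ‖z‖))
    (hL2 : MemLp (fun x : ℝ => f x) 2) :
    ∀ᵐ ξ : ℝ, B < 2 * Real.pi * |ξ| → (𝓕 (hL2.toLp _) : Lp ℂ 2 (volume : Measure ℝ)) ξ = 0 := by
  have h : ∀ᵐ ξ : ℝ, ∀ n : ℕ, ξ ∈ {ξ : ℝ | B + 1 / (n + 1) < 2 * Real.pi * |ξ|} →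
      (𝓕 (hL2.toLp _) : Lp ℂ 2 (volume : Measure ℝ)) ξ = 0 := by
    rw [ae_all_iff]
    exact fun n => fourier_ae_eq_zero_of_lt hC hB
      (lt_add_of_pos_right B Nat.one_div_pos_of_nat) hf hgrowth hL2
  filter_upwards [h] with ξ hξ hBξ
  obtain ⟨n, hn⟩ := exists_nat_one_div_lt (sub_pos.mpr hBξ)
  exact hξ n (show B + 1 / ((n : ℝ) + 1) < _ by linarith)

open FourierTransform in
theorem SchwartzMap.integral_fourierInv_mul_eq_of_integrable (φ : SchwartzMap ℝ ℂ) {g : ℝ → ℂ}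
    (hg : Integrable g) : ∫ x, (𝓕⁻ φ) x * g x = ∫ ξ, φ ξ * 𝓕⁻ g ξ := by
  have h := VectorFourier.integral_fourierIntegral_smul_eq_flip (L := -innerₗ ℝ)
    (μ := volume) (ν := volume) (f := φ) (g := g)
    Real.continuous_fourierChar (by simp; fun_prop) φ.integrable hg
  have hflip : (-innerₗ ℝ).flip = -innerₗ ℝ := by
    ext
    simp
  rw [hflip] at h
  simp only [smul_eq_mul] at h
  rw [SchwartzMap.fourierInv_coe]
  exact h

open FourierTransform ContDiff in
/-- Fourier inversion for a square-integrable function whose Fourier transform is integrable. -/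
theorem ae_eq_fourierInv_fourier (u : Lp ℂ 2 (volume : Measure ℝ))
    (hu : Integrable (𝓕 u : Lp ℂ 2 (volume : Measure ℝ))) :
    ∀ᵐ x : ℝ, u x = 𝓕⁻ ((𝓕 u : Lp ℂ 2 (volume : Measure ℝ)) : ℝ → ℂ) x := by
  have hcont : Continuous (𝓕⁻ ((𝓕 u : Lp ℂ 2 (volume : Measure ℝ)) : ℝ → ℂ)) :=
    VectorFourier.fourierIntegral_continuous (L := -innerₗ ℝ) Real.continuous_fourierChar
      (by simp; fun_prop) hu
  refine ae_eq_of_integral_contDiff_smul_eq ((Lp.memLp _).locallyIntegrable one_le_two)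
    hcont.locallyIntegrable ?_
  intro g hg hgc
  have hg₁ : HasCompactSupport (Complex.ofRealCLM ∘ g) := hgc.comp_left rfl
  have hg₂ : ContDiff ℝ ∞ (Complex.ofRealCLM ∘ g) := by fun_prop
  obtain ⟨φ, hφg⟩ : ∃ φ : SchwartzMap ℝ ℂ, ∀ ξ, φ ξ = g ξ :=
    ⟨hg₁.toSchwartzMap hg₂, fun ξ => rfl⟩
  have h := congrArg (fun T => T φ) (Lp.fourierInv_toTemperedDistribution_eq (𝓕 u))
  simp only [TemperedDistribution.fourierInv_apply, Lp.toTemperedDistribution_apply,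
    FourierTransform.fourierInv_fourier_eq, smul_eq_mul] at h
  rw [φ.integral_fourierInv_mul_eq_of_integrable hu] at h
  simpa [hφg] using h.symm

theorem memLp_two_iff_lintegral_nnnorm_sq {α : Type*} [MeasurableSpace α] {μ : Measure α}
    {f : α → ℂ} (hf : AEStronglyMeasurable f μ) :
    MemLp f 2 μ ↔ (∫⁻ u, (‖f u‖₊ : ℝ≥0∞) ^ 2 ∂μ) < ⊤ := by
  rw [memLp_two_iff_integrable_sq_norm hf]
  have h : ∀ u, ‖‖f u‖ ^ 2‖ₑ = (‖f u‖₊ : ℝ≥0∞) ^ 2 := fun u => by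
    rw [enorm_pow, enorm_norm, enorm_eq_nnnorm]
  simp_rw [← h]
  exact ⟨fun hi => hi.2, fun hi => ⟨hf.norm.pow 2, hi⟩⟩

theorem differentiable_integral_Icc_exp_mul {B : ℝ} {h : ℝ → ℂ}
    (hh : IntegrableOn h (Icc (-B) B)) :
    Differentiable ℂ (fun z : ℂ => ∫ w in Icc (-B) B, Complex.exp (Complex.I * z * w) * h w) := by
  intro z₀
  have hm : ∀ z : ℂ, AEStronglyMeasurable (fun w : ℝ => Complex.exp (Complex.I * z * w) * h w)
      (volume.restrict (Icc (-B) B)) := fun z =>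
    (Continuous.aestronglyMeasurable (by fun_prop)).mul hh.aestronglyMeasurable
  have hb : ∀ z ∈ Metric.ball z₀ 1, ∀ w ∈ Icc (-B) B,
      ‖Complex.exp (Complex.I * z * w)‖ ≤ Real.exp ((‖z₀‖ + 1) * B) := by
    intro z hz w hw
    have hw' : |w| ≤ B := abs_le.mpr hw
    have hz' : ‖z‖ ≤ ‖z₀‖ + 1 := by
      have h1 := norm_le_norm_add_norm_sub' z z₀
      have h2 : ‖z - z₀‖ < 1 := by simpa [dist_eq_norm] using hz
      linarith
    refine (Complex.norm_exp_le_exp_norm _).trans (Real.exp_le_exp.mpr ?_)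
    simp only [norm_mul, Complex.norm_I, one_mul, Complex.norm_real, Real.norm_eq_abs]
    gcongr
  refine (hasDerivAt_integral_of_dominated_loc_of_deriv_le (μ := volume.restrict (Icc (-B) B))
    (F := fun (z : ℂ) (w : ℝ) => Complex.exp (Complex.I * z * w) * h w)
    (F' := fun (z : ℂ) (w : ℝ) => Complex.I * w * (Complex.exp (Complex.I * z * w) * h w))
    (bound := fun w : ℝ => B * (Real.exp ((‖z₀‖ + 1) * B) * ‖h w‖))
    (Metric.ball_mem_nhds z₀ one_pos)
    (Eventually.of_forall hm) ?_
    ((Continuous.aestronglyMeasurable (by fun_prop)).mul (hm z₀)) ?_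
    ((hh.norm.const_mul _).const_mul _) ?_).2.differentiableAt
  · refine (hh.norm.const_mul (Real.exp ((‖z₀‖ + 1) * B))).mono' (hm z₀) ?_
    filter_upwards [ae_restrict_mem measurableSet_Icc] with w hw
    rw [norm_mul]
    gcongr
    exact hb z₀ (Metric.mem_ball_self one_pos) w hw
  · filter_upwards [ae_restrict_mem measurableSet_Icc] with w hw z hz
    have hw' : |w| ≤ B := abs_le.mpr hw
    rw [norm_mul, norm_mul, norm_mul, Complex.norm_I, one_mul, Complex.norm_real, Real.norm_eq_abs]
    gcongr
    · exact (abs_nonneg w).trans hw'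
    · exact hb z hz w hw
  · refine Eventually.of_forall fun w z _ => ?_
    have h1 : HasDerivAt (fun z : ℂ => Complex.I * z * w) (Complex.I * w) z := by
      simpa using ((hasDerivAt_id z).const_mul Complex.I).mul_const (w : ℂ)
    refine (h1.cexp.mul_const (h w)).congr_deriv ?_
    ring

theorem Differentiable.eq_of_eq_on_real {f g : ℂ → ℂ} (hf : Differentiable ℂ f)
    (hg : Differentiable ℂ g) (h : ∀ x : ℝ, f x = g x) : f = g := by
  refine AnalyticOnNhd.eq_of_frequently_eq (z₀ := 0) (fun z _ => hf.analyticAt z)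
    (fun z _ => hg.analyticAt z) ?_
  have ht : Tendsto (fun x : ℝ => (x : ℂ)) (𝓝[≠] 0) (𝓝[≠] 0) := by
    refine tendsto_nhdsWithin_iff.mpr ⟨?_, ?_⟩
    · exact (Complex.continuous_ofReal.tendsto' 0 0 Complex.ofReal_zero).mono_left
        nhdsWithin_le_nhds
    · filter_upwards [self_mem_nhdsWithin] with x hx
      simpa using hx
  exact ht.frequently (Eventually.of_forall h).frequently

open FourierTransform in
theorem compact_type_PaleyWiener_forward (B C : ℝ) (hB : 0 < B) (hC : 0 < C)
    (f : ℂ → ℂ) (hf : Differentiable ℂ f)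
    (hgrowth : ∀ z : ℂ, ‖f z‖ ≤ C * Real.exp (B * ‖z‖))
    (hL2 : (∫⁻ u : ℝ, (‖f (u : ℂ)‖₊ : ℝ≥0∞) ^ 2) < ⊤) :
    ∃ h : ℝ → ℂ, Measurable h ∧
      (∀ᵐ w : ℝ ∂volume, B < |w| → h w = 0) ∧
      (∫⁻ w in Set.Icc (-B) B, (‖h w‖₊ : ℝ≥0∞) ^ 2) < ⊤ ∧
      ∀ z : ℂ, f z = (Real.sqrt (2 * Real.pi) : ℂ)⁻¹ *
        ∫ w in Set.Icc (-B) B, Complex.exp (Complex.I * z * (w : ℂ)) * h w := by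
  have hfc : Continuous (fun x : ℝ => f x) := hf.continuous.comp Complex.continuous_ofReal
  have hfL : MemLp (fun x : ℝ => f x) 2 :=
    (memLp_two_iff_lintegral_nnnorm_sq hfc.aestronglyMeasurable).mpr hL2
  set F : Lp ℂ 2 (volume : Measure ℝ) := 𝓕 (hfL.toLp _)
  have hπ : (0 : ℝ) < 2 * Real.pi := by positivity
  have hF0 : ∀ᵐ ξ : ℝ, B < 2 * Real.pi * |ξ| → F ξ = 0 :=
    fourier_ae_eq_zero hC hB hf hgrowth hfL
  have hFm : Measurable F := (Lp.stronglyMeasurable F).measurable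
  have hFsq : Integrable (fun ξ => ‖F ξ‖ ^ 2) :=
    (memLp_two_iff_integrable_sq_norm hFm.aestronglyMeasurable).mp (Lp.memLp F)
  have hmem : ∀ ξ : ℝ, 2 * Real.pi * ξ ∉ Icc (-B) B → B < 2 * Real.pi * |ξ| := by
    intro ξ hξ
    by_contra! hlt
    refine hξ (abs_le.mp ?_)
    rwa [abs_mul, abs_of_pos hπ]
  have hFi : Integrable F := by
    have h1 : IntegrableOn F (Icc (-(B / (2 * Real.pi))) (B / (2 * Real.pi))) :=
      ((Lp.memLp F).restrict _).integrable one_le_two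
    refine h1.integrable_of_ae_notMem_eq_zero ?_
    filter_upwards [hF0] with ξ hξ hξ'
    refine hξ ?_
    by_contra! hlt
    refine hξ' (abs_le.mp ?_)
    rw [le_div_iff₀ hπ]
    linarith
  have hinv : ∀ x : ℝ, f x = 𝓕⁻ (F : ℝ → ℂ) x := by
    have hcont : Continuous (𝓕⁻ (F : ℝ → ℂ)) :=
      VectorFourier.fourierIntegral_continuous (L := -innerₗ ℝ) Real.continuous_fourierChar
        (by simp; fun_prop) hFi
    have hae : (fun x : ℝ => f x) =ᵐ[volume] 𝓕⁻ (F : ℝ → ℂ) := by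
      filter_upwards [hfL.coeFn_toLp, ae_eq_fourierInv_fourier _ hFi] with x hx1 hx2
      rw [← hx1, hx2]
    exact congrFun ((hfc.ae_eq_iff_eq volume hcont).mp hae)
  set h : ℝ → ℂ := (Icc (-B) B).indicator
    (fun w => (Real.sqrt (2 * Real.pi) : ℂ)⁻¹ * F ((2 * Real.pi)⁻¹ * w)) with hh
  have hhm : Measurable h :=
    ((hFm.comp (measurable_const_mul _)).const_mul _).indicator measurableSet_Icc
  have hhL : MemLp h 2 := by
    refine MemLp.indicator measurableSet_Icc (MemLp.const_mul ?_ _)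
    refine (memLp_two_iff_integrable_sq_norm (f := fun w => F ((2 * Real.pi)⁻¹ * w))
      (hFm.comp (measurable_const_mul _)).aestronglyMeasurable).mpr ?_
    exact hFsq.comp_mul_left' (inv_ne_zero hπ.ne')
  refine ⟨h, hhm, Eventually.of_forall fun w hw => ?_, ?_, ?_⟩
  · have hw' : w ∉ Icc (-B) B := fun hw' => (abs_le.mpr hw').not_gt hw
    exact indicator_of_notMem hw' _
  · exact (memLp_two_iff_lintegral_nnnorm_sq hhm.aestronglyMeasurable).mp (hhL.restrict _)
  · refine congrFun (hf.eq_of_eq_on_real ((differentiable_integral_Icc_exp_mul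
      ((hhL.restrict _).integrable one_le_two)).const_mul _) fun x => ?_)
    have hsqrt : (Real.sqrt (2 * Real.pi) : ℂ)⁻¹ * (Real.sqrt (2 * Real.pi) : ℂ)⁻¹
        = ((2 * Real.pi)⁻¹ : ℝ) := by
      rw [← mul_inv, ← Complex.ofReal_mul, Real.mul_self_sqrt hπ.le, Complex.ofReal_inv]
    set k : ℝ → ℂ := (Icc (-B) B).indicator
      (fun w : ℝ => Complex.exp (Complex.I * x * w) * F ((2 * Real.pi)⁻¹ * w)) with hk
    have h1 : 𝓕⁻ (F : ℝ → ℂ) x = ∫ ξ : ℝ, k (2 * Real.pi * ξ) := by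
      rw [Real.fourierInv_eq']
      refine integral_congr_ae ?_
      filter_upwards [hF0] with ξ hξ
      by_cases hm : 2 * Real.pi * ξ ∈ Icc (-B) B
      · rw [hk, indicator_of_mem hm, inv_mul_cancel_left₀ hπ.ne', smul_eq_mul]
        congr 2
        simp
        ring
      · rw [hk, indicator_of_notMem hm, hξ (hmem ξ hm), smul_zero]
    rw [hinv x, h1, Measure.integral_comp_mul_left, abs_of_pos (inv_pos.mpr hπ), Complex.real_smul,
      hk, integral_indicator measurableSet_Icc, ← hsqrt, mul_assoc, ← integral_const_mul]
    congr 1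
    refine setIntegral_congr_fun measurableSet_Icc fun w hw => ?_
    simp only [hh, indicator_of_mem hw]
    ring
end

section
/- Let B > 0 and C > 0, and let f : ℂ → ℂ be an entire function such that |f(z)| ≤ C e^{B|z|} for all z ∈ ℂ and ∫_ℝ |f(u)|² du < ∞. Then for every z ∈ ℂ, f(z) = ∫_ℝ K_B(z − ξ) f(ξ) dξ, where K_B(ζ) = (1/(2π)) ∫_{-B}^{B} e^{iζw} dw. -/
open MeasureTheory Set
open scoped ENNReal NNReal

section

open Complex Filter Topology Interval

lemma norm_le_mul_exp_abs_im {f : ℂ → ℂ} {B C M : ℝ} (hf : Differentiable ℂ f)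
    (hgrowth : ∀ z : ℂ, ‖f z‖ ≤ C * Real.exp (B * ‖z‖)) (hM : ∀ x : ℝ, ‖f x‖ ≤ M) (z : ℂ) :
    ‖f z‖ ≤ M * Real.exp (B * |z.im|) := by
  have key : ∀ g : ℂ → ℂ, Differentiable ℂ g → (∀ z : ℂ, ‖g z‖ ≤ C * Real.exp (B * ‖z‖)) →
      (∀ x : ℝ, ‖g x‖ ≤ M) → ∀ w : ℂ, 0 ≤ w.re → ‖g (I * w) * cexp (-B * w)‖ ≤ M := by
    intro g hg hgr hgM w hw
    have hn : ∀ w : ℂ, ‖cexp (-B * w)‖ = Real.exp (-(B * w.re)) := by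
      intro w; rw [Complex.norm_exp]; simp
    have hgrI : ∀ w : ℂ, ‖g (I * w)‖ ≤ C * Real.exp (B * ‖w‖) := fun w => by
      simpa using hgr (I * w)
    refine PhragmenLindelof.right_half_plane_of_bounded_on_real
      (f := fun w => g (I * w) * cexp (-B * w)) (C := M) ?_ ?_ ?_ ?_ hw
    · exact Differentiable.diffContOnCl (by fun_prop)
    · refine ⟨1, by norm_num, B + |B|, ?_⟩
      refine Asymptotics.IsBigO.of_bound C (Eventually.of_forall fun w => ?_)
      rw [norm_mul, hn, Real.norm_of_nonneg (Real.exp_pos _).le, Real.rpow_one, add_mul,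
        Real.exp_add, ← mul_assoc]
      refine mul_le_mul (hgrI w) (Real.exp_le_exp.2 ?_) (Real.exp_pos _).le
        ((norm_nonneg _).trans (hgrI w))
      calc -(B * w.re) ≤ |B * w.re| := neg_le_abs _
        _ = |B| * |w.re| := abs_mul _ _
        _ ≤ |B| * ‖w‖ := by gcongr; exact abs_re_le_norm w
    · refine isBoundedUnder_of_eventually_le (a := C) ?_
      filter_upwards [eventually_ge_atTop 0] with x hx
      rw [norm_mul, hn]
      calc _ ≤ C * Real.exp (B * ‖(x : ℂ)‖) * Real.exp (-(B * (x : ℂ).re)) := by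
            gcongr; exact hgrI _
        _ = C := by
          rw [mul_assoc, ← Real.exp_add]; simp [abs_of_nonneg hx]
    · intro x
      have h1 : I * ((x : ℂ) * I) = ((-x : ℝ) : ℂ) := by
        push_cast; linear_combination (x : ℂ) * I_mul_I
      rw [norm_mul, hn, h1]
      simpa using hgM (-x)
  have fin : ∀ g : ℂ → ℂ, Differentiable ℂ g → (∀ z : ℂ, ‖g z‖ ≤ C * Real.exp (B * ‖z‖)) →
      (∀ x : ℝ, ‖g x‖ ≤ M) → ∀ z : ℂ, 0 ≤ z.im → ‖g z‖ ≤ M * Real.exp (B * z.im) := by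
    intro g hg hgr hgM z hz
    have := key g hg hgr hgM (-I * z) (by simpa using hz)
    have e : I * (-I * z) = z := by linear_combination (-z) * I_mul_I
    rw [e, norm_mul, Complex.norm_exp] at this
    have e2 : (-(B : ℂ) * (-I * z)).re = -(B * z.im) := by simp
    rwa [e2, Real.exp_neg, ← div_eq_mul_inv, div_le_iff₀ (Real.exp_pos _)] at this
  rcases le_total 0 z.im with h | h
  · simpa [abs_of_nonneg h] using fin f hf hgrowth hM z h
  · simpa [abs_of_nonpos h] using fin (fun z => f (-z)) (by fun_prop)
      (fun z => by simpa using hgrowth (-z)) (fun x => by simpa using hM (-x)) (-z) (by simpa using h)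

lemma exists_norm_le_of_integrable_sq {f : ℂ → ℂ} {B C : ℝ} (hB : 0 ≤ B) (hC : 0 ≤ C)
    (hf : Differentiable ℂ f)
    (hgrowth : ∀ z : ℂ, ‖f z‖ ≤ C * Real.exp (B * ‖z‖))
    (hL2 : Integrable fun x : ℝ => ‖f x‖ ^ 2) : ∃ M, ∀ x : ℝ, ‖f x‖ ≤ M := by
  obtain ⟨Φ, hΦ⟩ := hf.isExactOn_univ
  replace hΦ : ∀ z, HasDerivAt Φ (f z) z := fun z => hΦ z (mem_univ z)
  have hΦd : Differentiable ℂ Φ := fun z => (hΦ z).differentiableAt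
  have hfr : Continuous fun x : ℝ => f x := hf.continuous.comp continuous_ofReal
  set N := ∫ x : ℝ, ‖f x‖ ^ 2
  have hftc : ∀ x s : ℝ, Φ (x + s) - Φ x = ∫ t in x..x + s, f t := by
    intro x s
    rw [intervalIntegral.integral_eq_sub_of_hasDerivAt (f := fun t : ℝ => Φ t)
      (fun t _ => (hΦ t).comp_ofReal) (hfr.intervalIntegrable _ _)]
    push_cast; rfl
  have hreal : ∀ s ∈ Icc (0 : ℝ) 1, ∀ x : ℝ, ‖Φ (x + s) - Φ x‖ ≤ 1 + N := by
    intro s hs x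
    rw [hftc]
    have hle : x ≤ x + s := by linarith [hs.1]
    calc _ ≤ ∫ t in x..x + s, ‖f t‖ := intervalIntegral.norm_integral_le_integral_norm hle
      _ ≤ ∫ t in x..x + s, (1 + ‖f t‖ ^ 2) :=
        intervalIntegral.integral_mono_on hle (hfr.norm.intervalIntegrable _ _)
          ((continuous_const.add (hfr.norm.pow 2)).intervalIntegrable _ _)
          fun t _ => by nlinarith [sq_nonneg (‖f t‖ - 1 / 2)]
      _ = s + ∫ t in x..x + s, ‖f t‖ ^ 2 := by
        have hsq : Continuous fun t : ℝ => ‖f t‖ ^ 2 := hfr.norm.pow 2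
        rw [intervalIntegral.integral_add (by simp) (hsq.intervalIntegrable _ _)]
        simp
      _ ≤ 1 + N := by
        gcongr
        · exact hs.2
        · rw [intervalIntegral.integral_of_le hle]
          exact setIntegral_le_integral hL2 (Eventually.of_forall fun t => by positivity)
  have hgr : ∀ s ∈ Icc (0 : ℝ) 1, ∀ z : ℂ,
      ‖Φ (z + s) - Φ z‖ ≤ C * Real.exp B * Real.exp (B * ‖z‖) := by
    intro s hs z
    have hs1 : ‖(s : ℂ)‖ ≤ 1 := by simpa [abs_of_nonneg hs.1] using hs.2
    have := (convex_closedBall z 1).norm_image_sub_le_of_norm_hasDerivWithin_le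
      (f := Φ) (f' := f) (C := C * Real.exp B * Real.exp (B * ‖z‖)) (x := z) (y := z + s)
      (fun w _ => (hΦ w).hasDerivWithinAt) (fun w hw => ?_) (by simp) (by simpa using hs1)
    · refine this.trans (mul_le_of_le_one_right (by positivity) (by simpa using hs1))
    · refine (hgrowth w).trans ?_
      rw [mul_assoc, ← Real.exp_add]
      gcongr
      have : ‖w‖ ≤ ‖w - z‖ + ‖z‖ := by simpa using norm_add_le (w - z) z
      have h2 : ‖w - z‖ ≤ 1 := by simpa [dist_eq_norm] using hw
      nlinarith
  have hdiff : ∀ s ∈ Icc (0 : ℝ) 1, ∀ x : ℝ, ‖f (x + s) - f x‖ ≤ (1 + N) * Real.exp B := by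
    intro s hs x
    have hd : Differentiable ℂ fun z : ℂ => Φ (z + s) - Φ z := by fun_prop
    have hder : HasDerivAt (fun z : ℂ => Φ (z + s) - Φ z) (f (x + s) - f x) x :=
      ((hΦ (x + s)).comp_add_const (x : ℂ) (s : ℂ)).sub (hΦ x)
    rw [← hder.deriv]
    have hN : 0 ≤ 1 + N := (norm_nonneg _).trans (hreal s hs 0)
    refine (norm_deriv_le_of_forall_mem_sphere_norm_le one_pos hd.diffContOnCl
      (C := (1 + N) * Real.exp B) fun z hz => ?_).trans_eq (div_one _)
    refine (norm_le_mul_exp_abs_im hd (hgr s hs) (hreal s hs) z).trans ?_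
    have : |z.im| ≤ 1 := by
      have h1 : |(z - x).im| ≤ ‖z - x‖ := abs_im_le_norm _
      have h2 : ‖z - x‖ = 1 := by simpa [dist_eq_norm] using hz
      simpa [h2] using h1
    gcongr
    nlinarith
  refine ⟨(1 + N) + (1 + N) * Real.exp B, fun x => ?_⟩
  have h1 : f x = (∫ t in x..x + 1, f t) - ∫ s in (0 : ℝ)..1, (f (x + s) - f x) := by
    have hc : Continuous fun s : ℝ => f (x + s) := hf.continuous.comp (by fun_prop)
    rw [intervalIntegral.integral_sub (hc.intervalIntegrable _ _) (by simp)]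
    have := intervalIntegral.integral_comp_add_left (a := 0) (b := 1) (fun t : ℝ => f t) x
    push_cast at this
    rw [this]
    simp
  rw [h1]
  refine (norm_sub_le _ _).trans (add_le_add ?_ ?_)
  · rw [← hftc]; exact hreal 1 (by simp) x
  · refine (intervalIntegral.norm_integral_le_of_norm_le_const
      (C := (1 + N) * Real.exp B) fun s hs => ?_).trans_eq (by simp)
    rw [uIoc_of_le zero_le_one] at hs
    exact hdiff s ⟨hs.1.le, hs.2⟩ x

lemma integral_ofReal_eq_zero_of_norm_le_div_sq {G : ℂ → ℂ} {c R₀ : ℝ}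
    (hd : DifferentiableOn ℂ G {ζ | 0 ≤ ζ.im})
    (hb : ∀ ζ : ℂ, 0 ≤ ζ.im → R₀ ≤ ‖ζ‖ → ‖G ζ‖ ≤ c / ‖ζ‖ ^ 2)
    (hi : Integrable fun x : ℝ => G x) : ∫ x : ℝ, G x = 0 := by
  refine tendsto_nhds_unique
    (intervalIntegral_tendsto_integral hi tendsto_neg_atTop_atBot tendsto_id) ?_
  have hlim : Tendsto (fun R : ℝ => 4 * |c| / R) atTop (𝓝 0) :=
    tendsto_const_nhds.div_atTop tendsto_id
  refine squeeze_zero_norm' ?_ hlim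
  filter_upwards [eventually_ge_atTop R₀, eventually_gt_atTop 0] with R hR hR0
  have hbd : ∀ ζ : ℂ, 0 ≤ ζ.im → R ≤ ‖ζ‖ → ‖G ζ‖ ≤ |c| / R ^ 2 := by
    intro ζ h0 h1
    refine (hb ζ h0 (hR.trans h1)).trans ?_
    gcongr
    exact le_abs_self c
  have hrect := integral_boundary_rect_eq_zero_of_differentiableOn G ((-R : ℝ) : ℂ)
    (R + R * I) (hd.mono ?_)
  · have htop : ‖∫ x : ℝ in -R..R, G (x + R * I)‖ ≤ |c| / R ^ 2 * |R - -R| := by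
      refine intervalIntegral.norm_integral_le_of_norm_le_const fun x _ =>
        hbd _ (by simpa using hR0.le) ?_
      simpa [abs_of_pos hR0] using abs_im_le_norm ((x : ℂ) + R * I)
    have hside : ∀ a : ℝ, |a| = R → ‖∫ y : ℝ in 0..R, G (a + y * I)‖ ≤ |c| / R ^ 2 * |R - 0| := by
      intro a ha
      refine intervalIntegral.norm_integral_le_of_norm_le_const fun y hy => hbd _ ?_ ?_
      · rw [uIoc_of_le hR0.le] at hy; simpa using hy.1.le
      · simpa [ha] using abs_re_le_norm ((a : ℂ) + y * I)
    have h1 := hside R (abs_of_pos hR0)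
    have h2 := hside (-R) (by simp [abs_of_pos hR0])
    have heq : ∫ x in -R..R, G x = (∫ x : ℝ in -R..R, G (x + R * I))
        - I * (∫ y : ℝ in 0..R, G (R + y * I)) + I * ∫ y : ℝ in 0..R, G ((-R : ℝ) + y * I) := by
      simp at hrect ⊢
      linear_combination hrect
    simp only [id]
    rw [heq]
    have hcalc : |c| / R ^ 2 * |R - -R| + |c| / R ^ 2 * |R - 0| + |c| / R ^ 2 * |R - 0| =
        4 * |c| / R := by
      rw [sub_zero, sub_neg_eq_add, abs_of_pos hR0, abs_of_pos (add_pos hR0 hR0)]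
      field_simp
      ring
    refine (norm_add_le _ _).trans ?_
    refine (add_le_add_left (norm_sub_le _ _) _).trans ?_
    rw [norm_mul, norm_mul, norm_I, one_mul, one_mul]
    linarith
  · rintro ζ ⟨_, h⟩
    simp only [mem_preimage] at h
    have : ζ.im ∈ [[(0 : ℝ), R]] := by simpa using h
    rw [uIcc_of_le hR0.le] at this
    exact this.1

lemma integral_ofReal_eq_zero_of_norm_le_div {G : ℂ → ℂ} {c R₀ : ℝ}
    (hd : DifferentiableOn ℂ G {ζ | 0 ≤ ζ.im})
    (hb : ∀ ζ : ℂ, 0 ≤ ζ.im → R₀ ≤ ‖ζ‖ → ‖G ζ‖ ≤ c / ‖ζ‖)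
    (hi : Integrable fun x : ℝ => G x) : ∫ x : ℝ, G x = 0 := by
  let D : ℕ → ℂ → ℂ := fun n ζ => 1 - I * (1 / ((n : ℝ) + 1) : ℝ) * ζ
  have hε : ∀ n : ℕ, 0 < 1 / ((n : ℝ) + 1) := fun n => Nat.one_div_pos_of_nat
  have hre : ∀ (n : ℕ) (ζ : ℂ), (D n ζ).re = 1 + (1 / ((n : ℝ) + 1)) * ζ.im := by
    intro n ζ; simp only [D, sub_re, mul_re, mul_im, I_re, I_im, ofReal_re, ofReal_im, one_re]; ring
  have him : ∀ (n : ℕ) (ζ : ℂ), (D n ζ).im = - ((1 / ((n : ℝ) + 1)) * ζ.re) := by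
    intro n ζ; simp only [D, sub_im, mul_re, mul_im, I_re, I_im, ofReal_re, ofReal_im, one_im]; ring
  have h1 : ∀ (n : ℕ) (ζ : ℂ), 0 ≤ ζ.im → 1 ≤ ‖D n ζ‖ := by
    intro n ζ h
    refine le_trans ?_ (re_le_norm _)
    rw [hre]
    have := mul_nonneg (hε n).le h
    linarith
  have h2 : ∀ (n : ℕ) (ζ : ℂ), 0 ≤ ζ.im → 1 / ((n : ℝ) + 1) * ‖ζ‖ ≤ ‖D n ζ‖ := by
    intro n ζ h
    refine (sq_le_sq₀ (mul_nonneg (hε n).le (norm_nonneg _)) (norm_nonneg _)).1 ?_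
    rw [mul_pow, Complex.sq_norm, Complex.sq_norm, normSq_apply, normSq_apply, hre, him]
    have := mul_nonneg (hε n).le h
    nlinarith
  have h0 : ∀ (n : ℕ) (ζ : ℂ), 0 ≤ ζ.im → D n ζ ≠ 0 := fun n ζ h =>
    norm_pos_iff.1 (one_pos.trans_le (h1 n ζ h))
  have hcont : ∀ n, Continuous fun x : ℝ => (D n x)⁻¹ := fun n =>
    Continuous.inv₀ (by fun_prop) fun x => h0 n x (by simp)
  have hle : ∀ n (x : ℝ), ‖(D n x)⁻¹ * G x‖ ≤ ‖G x‖ := by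
    intro n x
    rw [norm_mul, norm_inv]
    exact mul_le_of_le_one_left (norm_nonneg _) (inv_le_one_of_one_le₀ (h1 n x (by simp)))
  have hmeas : ∀ n, AEStronglyMeasurable (fun x : ℝ => (D n x)⁻¹ * G x) := fun n =>
    (hcont n).aestronglyMeasurable.mul hi.aestronglyMeasurable
  have hzero : ∀ n, ∫ x : ℝ, (D n x)⁻¹ * G x = 0 := by
    intro n
    refine integral_ofReal_eq_zero_of_norm_le_div_sq (G := fun ζ => (D n ζ)⁻¹ * G ζ)
      (c := c * ((n : ℝ) + 1)) (R₀ := max R₀ 1) ?_ ?_ ?_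
    · refine DifferentiableOn.mul (DifferentiableOn.inv (by fun_prop) fun ζ h => h0 n ζ h) hd
    · intro ζ h hR
      have hζ : 0 < ‖ζ‖ := one_pos.trans_le ((le_max_right _ _).trans hR)
      rw [norm_mul, norm_inv]
      calc _ ≤ (1 / ((n : ℝ) + 1) * ‖ζ‖)⁻¹ * (c / ‖ζ‖) := by
            gcongr
            · exact h2 n ζ h
            · exact hb ζ h ((le_max_left _ _).trans hR)
        _ = _ := by field_simp
    · exact hi.norm.mono' (hmeas n) (Eventually.of_forall (hle n))
  have hlim := tendsto_integral_of_dominated_convergence (fun x : ℝ => ‖G x‖) hmeas hi.norm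
    (fun n => Eventually.of_forall (hle n)) (f := fun x : ℝ => G x) (Eventually.of_forall fun x => by
      have : Tendsto (fun n : ℕ => (1 / ((n : ℝ) + 1) : ℝ)) atTop (𝓝 0) :=
        tendsto_one_div_add_atTop_nhds_zero_nat
      have hc : Tendsto (fun e : ℝ => (1 - I * (e : ℂ) * x)⁻¹ * G x) (𝓝 0) (𝓝 (G x)) := by
        have : ContinuousAt (fun e : ℝ => (1 - I * (e : ℂ) * x)⁻¹ * G x) 0 := by
          refine ContinuousAt.mul (ContinuousAt.inv₀ (by fun_prop) (by simp)) continuousAt_const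
        simpa using this.tendsto
      exact hc.comp this)
  simp only [hzero] at hlim
  exact (tendsto_nhds_unique tendsto_const_nhds hlim).symm

lemma integral_div_sub_eq_zero_of_im_neg {g : ℂ → ℂ} {M : ℝ} {z : ℂ} (hz : z.im < 0)
    (hg : Differentiable ℂ g) (hM : ∀ ζ : ℂ, 0 ≤ ζ.im → ‖g ζ‖ ≤ M)
    (hi : Integrable fun x : ℝ => g x / (x - z)) : ∫ x : ℝ, g x / (x - z) = 0 := by
  have hne : ∀ ζ : ℂ, 0 ≤ ζ.im → ζ - z ≠ 0 := fun ζ h h' => by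
    rw [sub_eq_zero.1 h'] at h; linarith
  refine integral_ofReal_eq_zero_of_norm_le_div (G := fun ζ => g ζ / (ζ - z)) (c := 2 * M)
    (R₀ := 2 * ‖z‖ + 1) (hg.differentiableOn.div (by fun_prop) hne) (fun ζ h hR => ?_) hi
  have h1 : ‖ζ‖ / 2 ≤ ‖ζ - z‖ := by
    have := norm_sub_norm_le ζ z
    linarith [norm_nonneg z]
  have h0 : 0 < ‖ζ‖ := by linarith [norm_nonneg z]
  rw [norm_div]
  calc _ ≤ M / (‖ζ‖ / 2) := by
        gcongr
        · exact (norm_nonneg _).trans (hM ζ h)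
        · exact hM ζ h
    _ = _ := by field_simp

lemma integral_poisson_kernel {z : ℂ} (hz : 0 < z.im) :
    Integrable (fun x : ℝ => (z - (starRingEnd ℂ) z) / ((x - (starRingEnd ℂ) z) * (x - z))) ∧
    ∫ x : ℝ, (z - (starRingEnd ℂ) z) / ((x - (starRingEnd ℂ) z) * (x - z)) = 2 * Real.pi * I := by
  have heq : ∀ x : ℝ, (z - (starRingEnd ℂ) z) / ((x - (starRingEnd ℂ) z) * (x - z)) =
      2 * I * ((z.im⁻¹ * (1 + ((x - z.re) / z.im) ^ 2)⁻¹ : ℝ) : ℂ) := by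
    intro x
    have hs : z - (starRingEnd ℂ) z = 2 * I * z.im := by
      rw [sub_conj]; push_cast; ring
    have hp : (x - (starRingEnd ℂ) z) * (x - z) = (((x - z.re) ^ 2 + z.im ^ 2 : ℝ) : ℂ) := by
      apply Complex.ext
      · simp [-ofReal_pow, pow_two]
      · simp [-ofReal_pow, pow_two]
        ring
    rw [hs, hp, mul_div_assoc, ← ofReal_div]
    congr 2
    have := hz.ne'
    have h2 : (x - z.re) ^ 2 + z.im ^ 2 ≠ 0 := by positivity
    field_simp
    ring_nf
  simp_rw [heq]
  have hi : Integrable fun x : ℝ => (1 + ((x - z.re) / z.im) ^ 2)⁻¹ :=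
    (integrable_inv_one_add_sq.comp_div hz.ne').comp_sub_right z.re
  refine ⟨((hi.const_mul _).ofReal).const_mul _, ?_⟩
  rw [integral_const_mul, integral_complex_ofReal, integral_const_mul,
    integral_sub_right_eq_self (fun x : ℝ => (1 + (x / z.im) ^ 2)⁻¹) z.re,
    Measure.integral_comp_div (fun x : ℝ => (1 + x ^ 2)⁻¹) z.im, integral_univ_inv_one_add_sq,
    abs_of_pos hz, smul_eq_mul, inv_mul_cancel_left₀ hz.ne']
  ring

lemma integral_div_sub_of_im_pos {g : ℂ → ℂ} {M : ℝ} {z : ℂ} (hz : 0 < z.im)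
    (hg : Differentiable ℂ g) (hM : ∀ ζ : ℂ, 0 ≤ ζ.im → ‖g ζ‖ ≤ M)
    (hi : Integrable fun x : ℝ => g x / (x - z)) :
    ∫ x : ℝ, g x / (x - z) = 2 * Real.pi * I * g z := by
  obtain ⟨hki, hk⟩ := integral_poisson_kernel hz
  set w := (starRingEnd ℂ) z with hw
  have hwim : w.im = -z.im := conj_im z
  let k : ℂ → ℂ := fun ζ => g ζ - g z * ((z - w) / (ζ - w))
  have hne : ∀ ζ : ℂ, -z.im < ζ.im → ζ - w ≠ 0 := fun ζ h h' => by
    rw [sub_eq_zero.1 h'] at h; linarith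
  have hkz : k z = 0 := by
    simp only [k]; rw [div_self (hne z (by linarith))]; ring
  have hU : {ζ : ℂ | -z.im < ζ.im} ∈ 𝓝 z :=
    (isOpen_lt continuous_const continuous_im).mem_nhds (by simp only [mem_ofPred_eq]; linarith)
  have hkd : DifferentiableOn ℂ k {ζ : ℂ | -z.im < ζ.im} := by
    refine hg.differentiableOn.sub (DifferentiableOn.const_mul ?_ _)
    exact (differentiableOn_const _).div (by fun_prop) hne
  have hGd : DifferentiableOn ℂ (dslope k z) {ζ : ℂ | 0 ≤ ζ.im} :=
    ((differentiableOn_dslope hU).2 hkd).mono fun ζ h => by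
      simp only [mem_ofPred_eq] at h ⊢; linarith
  have hGeq : ∀ ζ : ℂ, ζ ≠ z → dslope k z ζ = k ζ / (ζ - z) := fun ζ h => by
    rw [dslope_of_ne _ h, slope_def_field, hkz, sub_zero]
  have hreal : ∀ x : ℝ, (x : ℂ) ≠ z := fun x h => by
    rw [← h] at hz; simp at hz
  have hGx : ∀ x : ℝ, dslope k z x = g x / (x - z) - g z * ((z - w) / ((x - w) * (x - z))) := by
    intro x
    rw [hGeq x (hreal x)]
    simp only [k]
    rw [sub_div, mul_div_assoc, div_div]
  have hG0 : ∫ x : ℝ, dslope k z x = 0 := by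
    refine integral_ofReal_eq_zero_of_norm_le_div (c := 6 * M) (R₀ := 2 * ‖z‖ + 1) hGd ?_ ?_
    · intro ζ h hR
      have h1 : ‖ζ‖ / 2 ≤ ‖ζ - z‖ := by
        have := norm_sub_norm_le ζ z
        linarith [norm_nonneg z]
      have h0 : 0 < ‖ζ‖ := by linarith [norm_nonneg z]
      have hζz : ζ ≠ z := fun h' => by rw [h'] at hR; linarith [norm_nonneg z]
      have hM0 : 0 ≤ M := (norm_nonneg _).trans (hM ζ h)
      have h2 : ‖(z - w) / (ζ - w)‖ ≤ 2 := by
        have hz2 : ‖z - w‖ = 2 * z.im := by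
          rw [hw, sub_conj]; simp [abs_of_pos hz]
        have : z.im ≤ ‖ζ - w‖ := by
          refine le_trans ?_ (le_trans (le_abs_self _) (abs_im_le_norm _))
          rw [sub_im, hwim]; linarith
        rw [norm_div, hz2, div_le_iff₀ (hz.trans_le this)]
        linarith
      rw [hGeq ζ hζz, norm_div]
      calc _ ≤ (M + M * 2) / (‖ζ‖ / 2) := by
            gcongr
            refine (norm_sub_le _ _).trans (add_le_add (hM ζ h) ?_)
            rw [norm_mul]
            exact mul_le_mul (hM z hz.le) h2 (norm_nonneg _) hM0
        _ = _ := by field_simp; ring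
    · simp_rw [hGx]
      exact hi.sub (hki.const_mul _)
  simp_rw [hGx] at hG0
  rw [integral_sub hi (hki.const_mul _), integral_const_mul, hk, sub_eq_zero] at hG0
  rw [hG0]; ring

lemma integrable_div_sub {g : ℝ → ℂ} {z : ℂ} (hz : z.im ≠ 0) (hg : MemLp g 2) :
    Integrable fun x : ℝ => g x / (x - z) := by
  have hne : ∀ x : ℝ, (x : ℂ) - z ≠ 0 := fun x h => hz <| by
    rw [← sub_eq_zero.1 h, ofReal_im]
  have hc : Continuous fun x : ℝ => ((x : ℂ) - z)⁻¹ := Continuous.inv₀ (by fun_prop) hne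
  have hinv : MemLp (fun x : ℝ => ((x : ℂ) - z)⁻¹) 2 := by
    rw [memLp_two_iff_integrable_sq_norm hc.aestronglyMeasurable]
    have hi : Integrable fun x : ℝ => (z.im ^ 2)⁻¹ * (1 + ((x - z.re) / z.im) ^ 2)⁻¹ :=
      ((integrable_inv_one_add_sq.comp_div hz).comp_sub_right z.re).const_mul _
    refine hi.congr (Eventually.of_forall fun x => ?_)
    simp only [norm_inv, inv_pow, Complex.sq_norm, normSq_apply, sub_re, sub_im, ofReal_re,
      ofReal_im, ← mul_inv]
    congr 1
    field_simp
    ring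
  simp only [div_eq_mul_inv]
  exact hg.integrable_mul hinv

/-- The reproducing kernel of the Paley–Wiener space of band limit `B`. -/
noncomputable def paleyWienerKernel (B : ℝ) (ζ : ℂ) : ℂ :=
  (2 * (Real.pi : ℂ))⁻¹ * ∫ w in Set.Icc (-B) B, Complex.exp (Complex.I * ζ * (w : ℂ))

lemma paleyWienerKernel_eq_intervalIntegral {B : ℝ} (hB : 0 ≤ B) (ζ : ℂ) :
    paleyWienerKernel B ζ = (2 * (Real.pi : ℂ))⁻¹ * ∫ w in -B..B, cexp (I * ζ * w) := by
  rw [paleyWienerKernel, integral_Icc_eq_integral_Ioc,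
    ← intervalIntegral.integral_of_le (neg_le_self hB)]

lemma paleyWienerKernel_eq_div {B : ℝ} (hB : 0 ≤ B) {ζ : ℂ} (hζ : ζ ≠ 0) :
    paleyWienerKernel B ζ = (cexp (I * B * ζ) - cexp (-(I * B * ζ))) / (2 * Real.pi * I * ζ) := by
  rw [paleyWienerKernel_eq_intervalIntegral hB,
    integral_exp_mul_complex (mul_ne_zero I_ne_zero hζ), inv_mul_eq_div, div_div]
  push_cast
  ring_nf

lemma paleyWienerKernel_neg {B : ℝ} (hB : 0 ≤ B) (ζ : ℂ) :
    paleyWienerKernel B (-ζ) = paleyWienerKernel B ζ := by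
  rcases eq_or_ne ζ 0 with rfl | hζ
  · rw [neg_zero]
  · rw [paleyWienerKernel_eq_div hB hζ, paleyWienerKernel_eq_div hB (neg_ne_zero.2 hζ),
      mul_neg, mul_neg, neg_neg, ← neg_sub (cexp _), neg_div_neg_eq]

lemma continuous_paleyWienerKernel {B : ℝ} (hB : 0 ≤ B) : Continuous (paleyWienerKernel B) := by
  simp only [funext (paleyWienerKernel_eq_intervalIntegral hB)]
  exact continuous_const.mul
    (intervalIntegral.continuous_parametric_intervalIntegral_of_continuous' (by fun_prop) _ _)

lemma norm_paleyWienerKernel_le {B : ℝ} (hB : 0 ≤ B) (ζ : ℂ) :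
    ‖paleyWienerKernel B ζ‖ ≤ (B + 1) * Real.exp (B * |ζ.im|) / (‖ζ‖ + 1) := by
  have hpi : 1 ≤ Real.pi := by linarith [Real.pi_gt_three]
  have hE := Real.exp_pos (B * |ζ.im|)
  have hexp : ∀ w : ℝ, |w| ≤ B → ‖cexp (I * ζ * w)‖ ≤ Real.exp (B * |ζ.im|) := by
    intro w hw
    rw [Complex.norm_exp]
    have : (I * ζ * w).re = -(w * ζ.im) := by simp [mul_comm]
    rw [this, Real.exp_le_exp]
    calc -(w * ζ.im) ≤ |w| * |ζ.im| := by rw [← abs_mul]; exact neg_le_abs _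
      _ ≤ _ := by gcongr
  have h1 : ‖paleyWienerKernel B ζ‖ ≤ B * Real.exp (B * |ζ.im|) := by
    have hint : ‖∫ w in -B..B, cexp (I * ζ * w)‖ ≤ Real.exp (B * |ζ.im|) * |B - -B| := by
      refine intervalIntegral.norm_integral_le_of_norm_le_const fun w hw => hexp w ?_
      rw [uIoc_of_le (neg_le_self hB)] at hw
      exact abs_le.2 ⟨hw.1.le, hw.2⟩
    rw [sub_neg_eq_add, abs_of_nonneg (add_nonneg hB hB)] at hint
    rw [paleyWienerKernel_eq_intervalIntegral hB, norm_mul, norm_inv]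
    have h2pi : ‖2 * (Real.pi : ℂ)‖ = 2 * Real.pi := by simp [abs_of_pos Real.pi_pos]
    rw [h2pi, inv_mul_le_iff₀ (by positivity)]
    nlinarith [mul_nonneg hB hE.le]
  have h2 : ‖paleyWienerKernel B ζ‖ * ‖ζ‖ ≤ Real.exp (B * |ζ.im|) := by
    rcases eq_or_ne ζ 0 with rfl | hζ
    · simp
    · have hp := hexp B (abs_of_nonneg hB).le
      have hm := hexp (-B) (by rw [abs_neg, abs_of_nonneg hB])
      have hs : ‖cexp (I * B * ζ) - cexp (-(I * B * ζ))‖ ≤ 2 * Real.exp (B * |ζ.im|) := by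
        refine (norm_sub_le _ _).trans ?_
        have e1 : I * B * ζ = I * ζ * (B : ℝ) := by ring
        have e2 : -(I * B * ζ) = I * ζ * ((-B : ℝ) : ℂ) := by push_cast; ring
        rw [e2, e1]
        linarith
      have hn : ‖2 * Real.pi * I * ζ‖ = 2 * Real.pi * ‖ζ‖ := by simp [abs_of_pos Real.pi_pos]
      have hζ0 := norm_pos_iff.2 hζ
      rw [paleyWienerKernel_eq_div hB hζ, norm_div, hn, div_mul_eq_mul_div,
        div_le_iff₀ (by positivity)]
      nlinarith [mul_le_mul_of_nonneg_right hs hζ0.le, mul_pos hE hζ0]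
  rw [le_div_iff₀ (by positivity)]
  linarith

lemma eq_integral_paleyWienerKernel_of_im_neg {B M : ℝ} (hB : 0 ≤ B) {f : ℂ → ℂ}
    (hf : Differentiable ℂ f) (hM : ∀ z : ℂ, ‖f z‖ ≤ M * Real.exp (B * |z.im|))
    (hL2 : MemLp (fun x : ℝ => f x) 2) {z : ℂ} (hz : z.im < 0) :
    f z = ∫ ξ : ℝ, paleyWienerKernel B (z - ξ) * f ξ := by
  have hne : ∀ x : ℝ, (x : ℂ) - z ≠ 0 := fun x h => hz.ne <| by
    rw [← sub_eq_zero.1 h, ofReal_im]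
  have hunit : ∀ x : ℝ, ‖cexp (I * B * x)‖ = 1 := fun x => by
    rw [Complex.norm_exp]; simp
  have hbdd : ∀ h : ℂ → ℂ, (∀ z : ℂ, ‖h z‖ ≤ M * Real.exp (B * |z.im|)) →
      ∀ ζ : ℂ, 0 ≤ ζ.im → ‖cexp (I * B * ζ) * h ζ‖ ≤ M := by
    intro h hh ζ hζ
    have h1 := hh ζ
    rw [abs_of_nonneg hζ] at h1
    have h2 : (I * B * ζ).re = -(B * ζ.im) := by simp
    rw [norm_mul, Complex.norm_exp, h2]
    calc _ ≤ Real.exp (-(B * ζ.im)) * (M * Real.exp (B * ζ.im)) := by gcongr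
      _ = M := by rw [mul_left_comm, ← Real.exp_add]; simp
  have hmem : ∀ h : ℂ → ℂ, Differentiable ℂ h → MemLp (fun x : ℝ => h x) 2 →
      MemLp (fun x : ℝ => cexp (I * B * x) * h x) 2 := by
    intro h hd hm
    have hc := hd.continuous
    refine hm.of_le (Continuous.aestronglyMeasurable (by fun_prop)) (Eventually.of_forall fun x => ?_)
    rw [norm_mul, hunit, one_mul]
  have hfneg : Differentiable ℂ fun ζ => f (-ζ) := by fun_prop
  have hL2neg : MemLp (fun x : ℝ => f (-x)) 2 := by
    simpa [Function.comp_def] using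
      hL2.comp_measurePreserving (Measure.measurePreserving_neg (volume : Measure ℝ))
  have hi₁ := integrable_div_sub hz.ne (hmem f hf hL2)
  have hz' : 0 < (-z).im := by simpa using hz
  have hi₂ := integrable_div_sub hz'.ne' (hmem _ hfneg hL2neg)
  have h₁ := integral_div_sub_eq_zero_of_im_neg hz (g := fun ζ => cexp (I * B * ζ) * f ζ)
    (by fun_prop) (hbdd f hM) hi₁
  have h₂ := integral_div_sub_of_im_pos hz' (g := fun ζ => cexp (I * B * ζ) * f (-ζ))
    (by fun_prop) (hbdd _ fun z => by simpa using hM (-z)) hi₂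
  have hi₃ := hi₂.comp_neg
  rw [← integral_neg_eq_self] at h₂
  have hpi : (2 * Real.pi * I : ℂ) ≠ 0 := two_pi_I_ne_zero
  have hK : ∀ x : ℝ, paleyWienerKernel B (z - x) * f x =
      (2 * Real.pi * I)⁻¹ * (cexp (-(I * B * z)) * (cexp (I * B * x) * f x / (x - z)) +
        cexp (I * B * z) * (cexp (I * B * (-x : ℝ)) * f (-(-x : ℝ)) / ((-x : ℝ) - -z))) := by
    intro x
    have hx := hne x
    have hx' : z - x ≠ 0 := fun h => hx (by rw [← neg_sub, h, neg_zero])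
    have hx'' : -(x : ℂ) - -z ≠ 0 := by rwa [neg_sub_neg]
    have e1 : cexp (I * B * (z - x)) = cexp (I * B * z) * cexp (I * B * (-x)) := by
      rw [← Complex.exp_add]; ring_nf
    have e2 : cexp (-(I * B * (z - x))) = cexp (-(I * B * z)) * cexp (I * B * x) := by
      rw [← Complex.exp_add]; ring_nf
    rw [paleyWienerKernel_eq_div hB hx', e1, e2]
    push_cast
    rw [neg_neg, neg_sub_neg, ← neg_sub z (x : ℂ)]
    field_simp
    ring
  simp_rw [hK]
  rw [integral_const_mul, integral_add (hi₁.const_mul _) (hi₃.const_mul _), integral_const_mul,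
    integral_const_mul, h₁, h₂]
  have e3 : cexp (I * B * z) * cexp (I * B * -z) = 1 := by
    rw [← Complex.exp_add]; simp
  rw [neg_neg, mul_zero, zero_add, mul_left_comm (cexp _), inv_mul_cancel_left₀ hpi,
    ← mul_assoc (cexp _), e3, one_mul]

lemma eq_integral_paleyWienerKernel_of_im_nonpos {B M : ℝ} (hB : 0 ≤ B) {f : ℂ → ℂ}
    (hf : Differentiable ℂ f) (hM : ∀ z : ℂ, ‖f z‖ ≤ M * Real.exp (B * |z.im|))
    (hL2 : MemLp (fun x : ℝ => f x) 2) {z : ℂ} (hz : z.im ≤ 0) :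
    f z = ∫ ξ : ℝ, paleyWienerKernel B (z - ξ) * f ξ := by
  let u : ℕ → ℂ := fun n => z - I * (1 / ((n : ℝ) + 1) : ℝ)
  have hpos : ∀ n : ℕ, 0 < 1 / ((n : ℝ) + 1) := fun n => Nat.one_div_pos_of_nat
  have hle1 : ∀ n : ℕ, 1 / ((n : ℝ) + 1) ≤ 1 := fun n => by
    rw [div_le_one (by positivity)]; linarith [n.cast_nonneg (α := ℝ)]
  have hure : ∀ n, (u n).re = z.re := fun n => by
    simp only [u, sub_re, mul_re, I_re, I_im, ofReal_re, ofReal_im]; ring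
  have huim : ∀ n, (u n).im = z.im - 1 / ((n : ℝ) + 1) := fun n => by
    simp only [u, sub_im, mul_im, I_re, I_im, ofReal_re, ofReal_im]; ring
  have hu : Tendsto u atTop (𝓝 z) := by
    have h0 : Tendsto (fun n : ℕ => (1 / ((n : ℝ) + 1) : ℝ)) atTop (𝓝 0) :=
      tendsto_one_div_add_atTop_nhds_zero_nat
    have hc : Continuous fun e : ℝ => z - I * (e : ℂ) := by fun_prop
    have h := (hc.tendsto 0).comp h0
    rwa [ofReal_zero, mul_zero, sub_zero] at h
  have hfr : Continuous fun x : ℝ => f x := hf.continuous.comp continuous_ofReal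
  have hKc := continuous_paleyWienerKernel hB
  let z₀ : ℂ := z.re - I
  have hz₀ : z₀.im ≠ 0 := by simp [z₀]
  let D : ℝ := (B + 1) * Real.exp (B * (|z.im| + 1))
  have hbound : ∀ (n : ℕ) (x : ℝ),
      ‖paleyWienerKernel B (u n - x) * f x‖ ≤ D * ‖f x / (x - z₀)‖ := by
    intro n x
    have him : |(u n - x).im| ≤ |z.im| + 1 := by
      rw [sub_im, ofReal_im, sub_zero, huim]
      refine (abs_sub _ _).trans ?_
      rw [abs_of_pos (hpos n)]
      linarith [hle1 n]
    have hden : ‖(x : ℂ) - z₀‖ ≤ ‖u n - x‖ + 1 := by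
      have h1 : (x : ℂ) - z₀ = ((x - z.re : ℝ) : ℂ) + I := by simp only [z₀]; push_cast; ring
      have h2 := abs_re_le_norm (u n - x)
      rw [sub_re, hure, ofReal_re, abs_sub_comm] at h2
      rw [h1]
      refine (norm_add_le _ _).trans ?_
      rw [norm_I, norm_real, Real.norm_eq_abs]
      linarith
    have hden0 : 0 < ‖(x : ℂ) - z₀‖ := norm_pos_iff.2 fun h => hz₀ <| by
      rw [← sub_eq_zero.1 h, ofReal_im]
    rw [norm_mul, norm_div, mul_div_assoc', mul_div_right_comm]
    gcongr
    refine (norm_paleyWienerKernel_le hB _).trans ?_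
    simp only [D]
    gcongr
  have hlim := tendsto_integral_of_dominated_convergence (fun x : ℝ => D * ‖f x / (x - z₀)‖)
    (F := fun n (x : ℝ) => paleyWienerKernel B (u n - x) * f x)
    (f := fun x : ℝ => paleyWienerKernel B (z - x) * f x)
    (fun n => Continuous.aestronglyMeasurable
      ((hKc.comp (by fun_prop : Continuous fun x : ℝ => u n - (x : ℂ))).mul hfr))
    ((integrable_div_sub hz₀ hL2).norm.const_mul D)
    (fun n => Eventually.of_forall (hbound n))
    (Eventually.of_forall fun x =>
      ((hKc.tendsto _).comp (hu.sub_const (x : ℂ))).mul tendsto_const_nhds)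
  refine tendsto_nhds_unique ((hf.continuous.tendsto z).comp hu) (hlim.congr fun n => ?_)
  refine (eq_integral_paleyWienerKernel_of_im_neg hB hf hM hL2 ?_).symm
  rw [huim]
  linarith [hpos n]

theorem PaleyWiener_space_reproducing_kernel (B C : ℝ) (hB : 0 < B) (hC : 0 < C)
    (f : ℂ → ℂ) (hf : Differentiable ℂ f)
    (hgrowth : ∀ z : ℂ, ‖f z‖ ≤ C * Real.exp (B * ‖z‖))
    (hL2 : (∫⁻ u : ℝ, (‖f (u : ℂ)‖₊ : ℝ≥0∞) ^ 2) < ⊤) :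
    ∀ z : ℂ, f z = ∫ ξ : ℝ,
      ((2 * (Real.pi : ℂ))⁻¹ *
        ∫ w in Set.Icc (-B) B, Complex.exp (Complex.I * (z - (ξ : ℂ)) * (w : ℂ))) *
      f (ξ : ℂ) := by
  intro z
  have hfr : Continuous fun x : ℝ => f x := hf.continuous.comp continuous_ofReal
  have hmem : MemLp (fun x : ℝ => f x) 2 := by
    refine ⟨hfr.aestronglyMeasurable, ?_⟩
    rw [eLpNorm_lt_top_iff_lintegral_rpow_enorm_lt_top two_ne_zero ENNReal.ofNat_ne_top]
    simpa [enorm_eq_nnnorm] using hL2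
  obtain ⟨M, hM⟩ := exists_norm_le_of_integrable_sq hB.le hC.le hf hgrowth
    ((memLp_two_iff_integrable_sq_norm hfr.aestronglyMeasurable).1 hmem)
  have hbd := norm_le_mul_exp_abs_im hf hgrowth hM
  change f z = ∫ ξ : ℝ, paleyWienerKernel B (z - ξ) * f ξ
  rcases le_total z.im 0 with hz | hz
  · exact eq_integral_paleyWienerKernel_of_im_nonpos hB.le hf hbd hmem hz
  · have hmem' : MemLp (fun x : ℝ => f (-x)) 2 := by
      simpa [Function.comp_def] using
        hmem.comp_measurePreserving (Measure.measurePreserving_neg (volume : Measure ℝ))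
    have h := eq_integral_paleyWienerKernel_of_im_nonpos hB.le (f := fun ζ => f (-ζ)) (z := -z)
      (by fun_prop) (fun ζ => by simpa using hbd (-ζ)) hmem' (by simpa using hz)
    rw [neg_neg, ← integral_neg_eq_self] at h
    rw [h]
    refine integral_congr_ae (Eventually.of_forall fun x => ?_)
    simp only [ofReal_neg, neg_neg]
    rw [← paleyWienerKernel_neg hB.le]
    ring_nf

end
end

section
/- Let 1 ≤ p < ∞ and let f : ℂ → ℂ be holomorphic on the open right half-plane Π₊ = {z ∈ ℂ : 0 < Re z} with M^p := ∫_0^∞ ∫_ℝ |f(u+iv)|^p dv du < ∞. Then for every u > 0, ∫_ℝ |f(u+iv)|^p dv ≤ (4/(π u)) · M^p. -/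
open MeasureTheory Set
open scoped ENNReal NNReal

theorem Complex.two_pi_mul_enorm_rpow_le_lintegral_circleMap {f : ℂ → ℂ} {c : ℂ} {R p : ℝ}
    (hR : 0 ≤ R) (hp : 1 ≤ p) (hf : DifferentiableOn ℂ f (Metric.closedBall c R)) :
    ENNReal.ofReal (2 * Real.pi) * ‖f c‖ₑ ^ p ≤
      ∫⁻ θ in Ioo (-Real.pi) Real.pi, ‖f (circleMap c R θ)‖ₑ ^ p := by
  have hcont : Continuous fun θ ↦ f (circleMap c R θ) :=
    hf.continuousOn.comp_continuous (continuous_circleMap c R)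
      fun θ ↦ Metric.sphere_subset_closedBall (circleMap_mem_sphere c hR θ)
  have hμ : volume (Ioo (-Real.pi) Real.pi) = ENNReal.ofReal (2 * Real.pi) := by
    rw [Real.volume_Ioo]; congr 1; ring
  have hπ0 : ENNReal.ofReal (2 * Real.pi) ≠ 0 := by
    simpa using Real.pi_pos
  have hmean : f c = (2 * Real.pi)⁻¹ • ∫ θ in Ioo (-Real.pi) Real.pi, f (circleMap c R θ) := by
    have h := DiffContOnCl.circleAverage (f := f) (c := c) (R := R)
      (hf.diffContOnCl_ball (by rw [abs_of_nonneg hR]))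
    have hper : Function.Periodic (fun θ ↦ f (circleMap c R θ)) (2 * Real.pi) :=
      fun θ ↦ by simp only [periodic_circleMap c R θ]
    have hshift := hper.intervalIntegral_add_eq 0 (-Real.pi)
    rw [zero_add, show -Real.pi + 2 * Real.pi = Real.pi by ring,
      intervalIntegral.integral_of_le (a := -Real.pi) (by linarith [Real.pi_pos]),
      integral_Ioc_eq_integral_Ioo] at hshift
    rw [← h, Real.circleAverage_def, hshift]
  set ν : Measure ℝ := (ENNReal.ofReal (2 * Real.pi))⁻¹ • volume.restrict (Ioo (-Real.pi) Real.pi)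
    with hν
  have : IsProbabilityMeasure ν :=
    ⟨by simp only [hν, Measure.smul_apply, Measure.restrict_apply_univ, hμ, smul_eq_mul]
        exact ENNReal.inv_mul_cancel hπ0 ENNReal.ofReal_ne_top⟩
  have hfc : f c = ∫ θ, f (circleMap c R θ) ∂ν := by
    rw [hν, integral_smul_measure, ENNReal.toReal_inv,
      ENNReal.toReal_ofReal Real.two_pi_pos.le, ← hmean]
  have hjensen := eLpNorm'_le_eLpNorm'_of_exponent_le one_pos hp ν hcont.aestronglyMeasurable
  have hle : ‖f c‖ₑ ^ p ≤ ∫⁻ θ, ‖f (circleMap c R θ)‖ₑ ^ p ∂ν := by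
    have hp0 : 0 < p := one_pos.trans_le hp
    have h1 : ‖f c‖ₑ ≤ eLpNorm' (fun θ ↦ f (circleMap c R θ)) p ν := by
      refine le_trans ?_ hjensen
      rw [hfc]
      simpa [eLpNorm'] using enorm_integral_le_lintegral_enorm (μ := ν) fun θ ↦ f (circleMap c R θ)
    calc ‖f c‖ₑ ^ p ≤ (eLpNorm' (fun θ ↦ f (circleMap c R θ)) p ν) ^ p := by gcongr
      _ = _ := by
        rw [eLpNorm', ← ENNReal.rpow_mul, one_div_mul_cancel hp0.ne', ENNReal.rpow_one]
  rw [hν, lintegral_smul_measure, smul_eq_mul] at hle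
  calc _ ≤ ENNReal.ofReal (2 * Real.pi) * ((ENNReal.ofReal (2 * Real.pi))⁻¹ * _) := by gcongr
    _ = _ := by rw [← mul_assoc, ENNReal.mul_inv_cancel hπ0 ENNReal.ofReal_ne_top, one_mul]

theorem lintegral_Ioo_zero_ofReal {r : ℝ} (hr : 0 ≤ r) :
    ∫⁻ ρ in Ioo 0 r, ENNReal.ofReal ρ = ENNReal.ofReal (r ^ 2 / 2) := by
  rw [← ofReal_integral_eq_lintegral_ofReal, ← integral_Ioc_eq_integral_Ioo,
    ← intervalIntegral.integral_of_le hr, integral_id]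
  · simp
  · exact (continuous_id.integrableOn_Icc).mono_set Ioo_subset_Icc_self
  · filter_upwards [ae_restrict_mem measurableSet_Ioo] with ρ hρ using hρ.1.le

theorem mul_le_lintegral_of_le_lintegral_circle {H : ℝ → ℝ≥0∞} (hH : Measurable H) {u r : ℝ}
    (hr : 0 ≤ r) {c : ℝ≥0∞}
    (h : ∀ ρ ∈ Ioo 0 r, c ≤ ∫⁻ θ in Ioo (-Real.pi) Real.pi, H (u + ρ * Real.cos θ)) :
    ENNReal.ofReal (r ^ 2 / 2) * c ≤ ENNReal.ofReal (2 * r) * ∫⁻ x in Ioo (u - r) (u + r), H x := by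
  set S : Set (ℝ × ℝ) := Ioo (-r) r ×ˢ Ioo (-r) r
  set G : ℝ × ℝ → ℝ≥0∞ := S.indicator fun q ↦ H (u + q.1)
  have hS : MeasurableSet S := measurableSet_Ioo.prod measurableSet_Ioo
  have hG : Measurable G := Measurable.indicator (by fun_prop) hS
  have hpolar : Measurable fun q : ℝ × ℝ ↦ ENNReal.ofReal q.1 • G (polarCoord.symm q) :=
    (by fun_prop : Measurable fun q : ℝ × ℝ ↦ ENNReal.ofReal q.1).mul
      (hG.comp continuous_polarCoord_symm.measurable)
  calc ENNReal.ofReal (r ^ 2 / 2) * c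
      = ∫⁻ ρ in Ioo 0 r, ENNReal.ofReal ρ * c := by
        rw [lintegral_mul_const _ (by fun_prop), lintegral_Ioo_zero_ofReal hr]
    _ ≤ ∫⁻ ρ in Ioo 0 r, ∫⁻ θ in Ioo (-Real.pi) Real.pi,
          ENNReal.ofReal ρ • G (polarCoord.symm (ρ, θ)) := by
        refine setLIntegral_mono' measurableSet_Ioo fun ρ hρ ↦ ?_
        have hmem (θ : ℝ) : polarCoord.symm (ρ, θ) ∈ S := by
          have hc := abs_le.1 (Real.abs_cos_le_one θ)
          have hs := abs_le.1 (Real.abs_sin_le_one θ)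
          have := hρ.1
          have := hρ.2
          simp only [polarCoord_symm_apply, S, mem_prod, mem_Ioo]
          refine ⟨⟨?_, ?_⟩, ?_, ?_⟩ <;> nlinarith
        have hG_eq (θ : ℝ) : G (polarCoord.symm (ρ, θ)) = H (u + ρ * Real.cos θ) :=
          indicator_of_mem (hmem θ) _
        simp only [hG_eq, smul_eq_mul]
        rw [lintegral_const_mul _ (by fun_prop)]
        gcongr
        exact h ρ hρ
    _ ≤ ∫⁻ ρ in Ioi 0, ∫⁻ θ in Ioo (-Real.pi) Real.pi,
          ENNReal.ofReal ρ • G (polarCoord.symm (ρ, θ)) :=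
        lintegral_mono_set Ioo_subset_Ioi_self
    _ = ∫⁻ q, G q := by
        rw [← lintegral_comp_polarCoord_symm, polarCoord_target, Measure.volume_eq_prod,
          ← Measure.prod_restrict, lintegral_prod _ hpolar.aemeasurable]
    _ = ∫⁻ x in Ioo (-r) r, ∫⁻ _ in Ioo (-r) r, H (u + x) := by
        rw [lintegral_indicator hS, Measure.volume_eq_prod, ← Measure.prod_restrict,
          lintegral_prod _ (by fun_prop)]
    _ = ENNReal.ofReal (2 * r) * ∫⁻ x in Ioo (-r) r, H (u + x) := by
        simp only [lintegral_const, Measure.restrict_apply_univ, Real.volume_Ioo]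
        rw [lintegral_mul_const _ (by fun_prop), mul_comm]
        ring_nf
    _ = _ := by
        have := (measurePreserving_add_left volume u).setLIntegral_comp_preimage
          (measurableSet_Ioo (a := u - r) (b := u + r)) hH
        rw [← this, preimage_const_add_Ioo]
        ring_nf

/-- The integral of `‖f‖ ^ p` along the vertical line at abscissa `u` satisfies the sub-mean value
property on circles. -/
theorem two_pi_mul_lintegral_vertical_le {f : ℂ → ℂ} (hf : DifferentiableOn ℂ f {z | 0 < z.re})
    {F : ℂ → ℝ≥0∞} (hF : Measurable F) {p : ℝ} (hp : 1 ≤ p)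
    (hfF : ∀ z : ℂ, 0 < z.re → F z = ‖f z‖ₑ ^ p) {u ρ : ℝ} (hρ : 0 ≤ ρ) (hu : ρ < u) :
    ENNReal.ofReal (2 * Real.pi) * ∫⁻ v : ℝ, F (u + v * Complex.I) ≤
      ∫⁻ θ in Ioo (-Real.pi) Real.pi,
        ∫⁻ v : ℝ, F ((u + ρ * Real.cos θ : ℝ) + v * Complex.I) := by
  have hball (v : ℝ) : Metric.closedBall (u + v * Complex.I) ρ ⊆ {z : ℂ | 0 < z.re} := by
    intro z hz
    have h1 := (Complex.abs_re_le_norm _).trans (mem_closedBall_iff_norm.1 hz)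
    have h2 := (abs_le.1 h1).1
    simp at h2
    change 0 < z.re
    linarith
  have hcircle (v θ : ℝ) : circleMap (u + v * Complex.I) ρ θ =
      (u + ρ * Real.cos θ : ℝ) + (v + ρ * Real.sin θ : ℝ) * Complex.I := by
    rw [circleMap, Complex.exp_mul_I]
    push_cast
    ring
  calc _ = ∫⁻ v : ℝ, ENNReal.ofReal (2 * Real.pi) * F (u + v * Complex.I) := by
        rw [lintegral_const_mul _ (by fun_prop)]
    _ ≤ ∫⁻ v : ℝ, ∫⁻ θ in Ioo (-Real.pi) Real.pi, F (circleMap (u + v * Complex.I) ρ θ) := by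
        refine lintegral_mono fun v ↦ ?_
        have hmem (θ : ℝ) := hball v
          (Metric.sphere_subset_closedBall (circleMap_mem_sphere (u + v * Complex.I) hρ θ))
        simp only [hfF _ (hmem _), hfF _ (hball v (Metric.mem_closedBall_self hρ))]
        exact Complex.two_pi_mul_enorm_rpow_le_lintegral_circleMap hρ hp (hf.mono (hball v))
    _ = ∫⁻ θ in Ioo (-Real.pi) Real.pi, ∫⁻ v : ℝ,
          F ((u + ρ * Real.cos θ : ℝ) + (v + ρ * Real.sin θ : ℝ) * Complex.I) := by
        simp only [hcircle]
        exact lintegral_lintegral_swap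
          (Measurable.aemeasurable (by simp only [Function.uncurry_def]; fun_prop))
    _ = _ := by
        refine lintegral_congr fun θ ↦ ?_
        exact lintegral_add_right_eq_self
          (fun v : ℝ ↦ F ((u + ρ * Real.cos θ : ℝ) + v * Complex.I)) (ρ * Real.sin θ)

theorem Bergman_vertical_line_Lp_estimate (p : ℝ) (hp : 1 ≤ p) (f : ℂ → ℂ)
    (hf : DifferentiableOn ℂ f {z : ℂ | 0 < z.re})
    (M : ℝ) (hM0 : 0 ≤ M)
    (hM : (∫⁻ u in Set.Ioi (0 : ℝ),
        ∫⁻ v : ℝ, (‖f ((u : ℂ) + (v : ℂ) * Complex.I)‖₊ : ℝ≥0∞) ^ p) =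
      ENNReal.ofReal (M ^ p)) :
    ∀ u : ℝ, 0 < u →
      (∫⁻ v : ℝ, (‖f ((u : ℂ) + (v : ℂ) * Complex.I)‖₊ : ℝ≥0∞) ^ p) ≤
        ENNReal.ofReal (4 / (Real.pi * u) * M ^ p) := by
  classical
  intro u hu
  have hopen : MeasurableSet {z : ℂ | 0 < z.re} :=
    measurableSet_lt measurable_const Complex.measurable_re
  set F : ℂ → ℝ≥0∞ := fun z ↦ ‖({z : ℂ | 0 < z.re}.piecewise f 0) z‖ₑ ^ p
  have hF : Measurable F :=
    ((hf.continuousOn.measurable_piecewise continuousOn_const hopen).enorm).pow_const p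
  have hfF (z : ℂ) (hz : 0 < z.re) : F z = ‖f z‖ₑ ^ p := by
    simp only [F, piecewise_eq_of_mem {z : ℂ | 0 < z.re} f 0 hz]
  set H : ℝ → ℝ≥0∞ := fun s ↦ ∫⁻ v : ℝ, F (s + v * Complex.I)
  have hH : Measurable H :=
    Measurable.lintegral_prod_right' (f := fun q : ℝ × ℝ ↦ F (q.1 + q.2 * Complex.I))
      (by fun_prop)
  have hHf {s : ℝ} (hs : 0 < s) :
      ∫⁻ v : ℝ, (‖f (s + v * Complex.I)‖₊ : ℝ≥0∞) ^ p = H s :=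
    lintegral_congr fun v ↦ (hfF _ (by simpa using hs)).symm
  have hHM : ∫⁻ s in Ioi 0, H s = ENNReal.ofReal (M ^ p) := by
    rw [← hM]
    exact setLIntegral_congr_fun measurableSet_Ioi fun s hs ↦ (hHf hs).symm
  have hdisc := mul_le_lintegral_of_le_lintegral_circle hH (u := u) (half_pos hu).le
    fun ρ hρ ↦ two_pi_mul_lintegral_vertical_le hf hF hp hfF hρ.1.le (hρ.2.trans (half_lt_self hu))
  have hstrip : ∫⁻ s in Ioo (u - u / 2) (u + u / 2), H s ≤ ENNReal.ofReal (M ^ p) :=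
    hHM ▸ lintegral_mono_set fun s hs ↦ mem_Ioi.2 (by linarith [hs.1])
  have hmain : ENNReal.ofReal ((u / 2) ^ 2 / 2 * (2 * Real.pi)) * H u ≤
      ENNReal.ofReal (2 * (u / 2) * M ^ p) := by
    rw [ENNReal.ofReal_mul (by positivity), mul_assoc,
      ENNReal.ofReal_mul (p := 2 * (u / 2)) (by positivity)]
    exact hdisc.trans (by gcongr)
  have ha : 0 < (u / 2) ^ 2 / 2 * (2 * Real.pi) := by positivity
  rw [hHf hu]
  calc H u ≤ ENNReal.ofReal (2 * (u / 2) * M ^ p) /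
        ENNReal.ofReal ((u / 2) ^ 2 / 2 * (2 * Real.pi)) := by
        rwa [ENNReal.le_div_iff_mul_le (by simp [ha]) (by simp), mul_comm]
    _ = _ := by
        rw [← ENNReal.ofReal_div_of_pos ha]
        congr 1
        field_simp
        ring
end
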